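/- arXiv:1602.05051 — 9 statements merged into one kernel-verified Lean document; each statement's English description precedes it below -/
import Mathlib

section
/- If ρ(A) ≤ 1, a24 > (1/2)·√(1 − 2s), a45 > (1/2)·√(1 − 2s), and a12 ≤ (1/2)·√(2(t + s)·S2 / (4·a45² + 2s − 1)), then λ3 ≤ 1/2. -/
open scoped InnerProductSpace

/-- A linear map into a space of dimension less than the number of eigenvalues of a real symmetric
matrix exceeding `μ` kills some vector whose Rayleigh quotient exceeds `μ`. -/
theorem Matrix.IsHermitian.exists_map_eq_zero_and_lt_inner {n E : Type*} [Fintype n] [DecidableEq n]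
    [AddCommGroup E] [Module ℝ E] [FiniteDimensional ℝ E] {A : Matrix n n ℝ} (hA : A.IsHermitian)
    (μ : ℝ) (f : EuclideanSpace ℝ n →ₗ[ℝ] E)
    (hf : Module.finrank ℝ E < Fintype.card {i // μ < hA.eigenvalues i}) :
    ∃ v, f v = 0 ∧ μ * ⟪v, v⟫_ℝ < ⟪v, Matrix.toEuclideanLin A v⟫_ℝ := by
  have hu : Orthonormal ℝ fun i : {i // μ < hA.eigenvalues i} => hA.eigenvectorBasis i :=
    hA.eigenvectorBasis.orthonormal.comp _ Subtype.val_injective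
  obtain ⟨c, hc, hc0⟩ := (Submodule.ne_bot_iff _).mp <|
    (f ∘ₗ Fintype.linearCombination ℝ fun i : {i // μ < hA.eigenvalues i} =>
      hA.eigenvectorBasis i).ker_ne_bot_of_finrank_lt (by simpa using hf)
  refine ⟨_, hc, ?_⟩
  have hAu (i : n) : Matrix.toEuclideanLin A (hA.eigenvectorBasis i)
      = hA.eigenvalues i • hA.eigenvectorBasis i := by
    ext j
    simpa using congrFun (hA.mulVec_eigenvectorBasis i) j
  simp only [Fintype.linearCombination_apply, map_sum, map_smul, hAu, smul_smul]
  rw [hu.inner_sum, hu.inner_sum, Finset.mul_sum]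
  obtain ⟨k, hk⟩ := Function.ne_iff.mp hc0
  have key (i : {i // μ < hA.eigenvalues i}) : c i * (c i * hA.eigenvalues i) - μ * (c i * c i)
      = (hA.eigenvalues i - μ) * c i ^ 2 := by ring
  refine Finset.sum_lt_sum (fun i _ => ?_) ⟨k, Finset.mem_univ _, ?_⟩
  · rw [← sub_nonneg]
    simp only [conj_trivial, key]
    exact mul_nonneg (sub_nonneg.mpr i.2.le) (sq_nonneg _)
  · rw [← sub_pos]
    simp only [conj_trivial, key]
    exact mul_pos (sub_pos.mpr k.2) (sq_pos_iff.mpr hk)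


/-- Pattern H: if `ρ(A) ≤ 1`, `a24 > √(1-2s)/2`, `a45 > √(1-2s)/2` and
`a12 ≤ √(2(t+s)S2/(4a45²+2s-1))/2`, then `l3 ≤ 1/2`. -/
theorem stmt_7
    (s t a12 a13 a24 a25 a35 a45 : ℝ)
    (hs : 0 ≤ s) (ht : 0 ≤ t) (h12n : 0 ≤ a12) (h13n : 0 ≤ a13)
    (h24n : 0 ≤ a24) (h25n : 0 ≤ a25) (h35n : 0 ≤ a35) (h45n : 0 ≤ a45)
    (hts : t + s ≤ 1/2)
    (A : Matrix (Fin 5) (Fin 5) ℝ)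
    (hA : A = !![1/2 - t - s, a12, a13, 0, 0;
                 a12, 0, 0, a24, a25;
                 a13, 0, t, 0, a35;
                 0, a24, 0, s, a45;
                 0, a25, a35, a45, 0])
    (l1 l2 l3 l4 l5 : ℝ)
    (hord1 : l1 ≥ l2) (hord2 : l2 ≥ l3) (hord3 : l3 ≥ l4) (hord4 : l4 ≥ l5)
    (heig : A.charpoly.roots = {l1, l2, l3, l4, l5})
    (S2 : ℝ) (hS2 : S2 = -1 + 2*s + 4*a24^2 + 4*(1 - 2*s)*a25^2 + 4*a45^2 + 16*a24*a25*a45)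
    (hρ : spectralRadius ℝ A ≤ 1)
    (h24 : a24 > 1/2 * Real.sqrt (1 - 2*s))
    (h45 : a45 > 1/2 * Real.sqrt (1 - 2*s))
    (h12 : a12 ≤ 1/2 * Real.sqrt (2 * (t + s) * S2 / (4*a45^2 + 2*s - 1))) :
    l3 ≤ 1/2 := by
  have hH : A.IsHermitian := by
    subst hA
    ext i j
    fin_cases i <;> fin_cases j <;> rfl
  by_contra! h3
  have hcard : 2 < Fintype.card {i // 1 / 2 < hH.eigenvalues i} := by
    have hcount := congrArg (Multiset.countP fun x : ℝ => 1 / 2 < x)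
      (hH.roots_charpoly_eq_eigenvalues.symm.trans heig)
    rw [Multiset.countP_map] at hcount
    rw [Fintype.card_subtype, Finset.card_def, Finset.filter_val]
    refine lt_of_lt_of_eq ?_ hcount.symm
    have h2 : 1 / 2 < l2 := by linarith
    have h1 : 1 / 2 < l1 := by linarith
    simp only [Multiset.insert_eq_cons, Multiset.countP_cons, h1, h2, h3, if_true]
    omega
  let f : EuclideanSpace ℝ (Fin 5) →ₗ[ℝ] ℝ × ℝ :=
    (EuclideanSpace.proj 2 : EuclideanSpace ℝ (Fin 5) →L[ℝ] ℝ).toLinearMap.prod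
      ((4 * a45 ^ 2 + 2 * s - 1) • (EuclideanSpace.proj 3 : _ →L[ℝ] ℝ).toLinearMap
        + (2 * a24 + 4 * a45 * a25) • (EuclideanSpace.proj 1 : _ →L[ℝ] ℝ).toLinearMap)
  obtain ⟨v, hfv, hv⟩ := hH.exists_map_eq_zero_and_lt_inner (1 / 2) f (by simpa using hcard)
  obtain ⟨hv2, hv3⟩ : v 2 = 0 ∧
      (4 * a45 ^ 2 + 2 * s - 1) * v 3 + (2 * a24 + 4 * a45 * a25) * v 1 = 0 := by
    simpa [f] using hfv
  have hsq : Real.sqrt (1 - 2 * s) ^ 2 = 1 - 2 * s := Real.sq_sqrt (by linarith)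
  have hD : 0 < 4 * a45 ^ 2 + 2 * s - 1 := by
    nlinarith [Real.sqrt_nonneg (1 - 2 * s)]
  have hS : 0 < S2 := by
    have : 0 ≤ (1 - 2 * s) * a25 ^ 2 := mul_nonneg (by linarith) (sq_nonneg _)
    have : 0 ≤ a24 * a25 * a45 := by positivity
    nlinarith [sq_nonneg a24]
  have hK : 4 * a12 ^ 2 * (4 * a45 ^ 2 + 2 * s - 1) ≤ 2 * (t + s) * S2 := by
    rw [← le_div_iff₀ hD,
      ← Real.sq_sqrt (show 0 ≤ 2 * (t + s) * S2 / (4 * a45 ^ 2 + 2 * s - 1) by positivity)]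
    nlinarith
  have hform : 0 < -2 * (t + s) * v 0 ^ 2 + 4 * a12 * v 0 * v 1 - v 1 ^ 2 + (2 * s - 1) * v 3 ^ 2
      - v 4 ^ 2 + 4 * a24 * v 1 * v 3 + 4 * a25 * v 1 * v 4 + 4 * a45 * v 3 * v 4 := by
    subst hA
    simp [EuclideanSpace.real_norm_sq_eq, PiLp.inner_apply, Fin.sum_univ_five, Matrix.mulVec, dotProduct, hv2] at hv
    linarith
  have hneg : S2 * ((4 * a45 ^ 2 + 2 * s - 1) *
      (-2 * (t + s) * v 0 ^ 2 + 4 * a12 * v 0 * v 1 - v 1 ^ 2 + (2 * s - 1) * v 3 ^ 2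
      - v 4 ^ 2 + 4 * a24 * v 1 * v 3 + 4 * a25 * v 1 * v 4 + 4 * a45 * v 3 * v 4)) =
      -(S2 * (4 * a45 ^ 2 + 2 * s - 1) * (v 4 - 2 * a45 * v 3 - 2 * a25 * v 1) ^ 2)
      - (S2 * v 1 - 2 * (4 * a45 ^ 2 + 2 * s - 1) * a12 * v 0) ^ 2
      - (4 * a45 ^ 2 + 2 * s - 1) * v 0 ^ 2 *
        (2 * (t + s) * S2 - 4 * a12 ^ 2 * (4 * a45 ^ 2 + 2 * s - 1)) := by
    linear_combination S2 * v 1 ^ 2 * hS2 +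
      S2 * ((4 * a45 ^ 2 + 2 * s - 1) * v 3 + (2 * a24 + 4 * a45 * a25) * v 1) * hv3
  have hpos := mul_pos hS (mul_pos hD hform)
  have hsquare := mul_nonneg (mul_pos hS hD).le (sq_nonneg (v 4 - 2 * a45 * v 3 - 2 * a25 * v 1))
  have hcorner := mul_nonneg (mul_nonneg hD.le (sq_nonneg (v 0))) (sub_nonneg.mpr hK)
  linarith [sq_nonneg (S2 * v 1 - 2 * (4 * a45 ^ 2 + 2 * s - 1) * a12 * v 0)]
end

section
/- If ρ(A) ≤ 1, a24 > (1/2)·√(1 − 2s), a45 > (1/2)·√(1 − 2s), and a12 > (1/2)·√(2(t + s)·S2 / (4·a45² + 2s − 1)), then a24 < (1/2)·√((3 − 2s)·(1 + 3t + 3s − 2√((1 + 2t + 2s)(t + s))) / (1 + t + s)) and a45 > √((1 − s)/2 − (1/4)·√(1 − (1 − 2s)(3 − 2s)(t + s)/(1 + t + s))). -/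
/-- A real symmetric matrix `A` with spectral radius at most `1` satisfies `A ≤ 1`. -/
theorem Matrix.IsHermitian.posSemidef_one_sub_of_spectralRadius_le_one {n : Type*} [Fintype n]
    [DecidableEq n] {A : Matrix n n ℝ} (hA : A.IsHermitian) (hρ : spectralRadius ℝ A ≤ 1) :
    (1 - A).PosSemidef := by
  have hB : (1 - A).IsHermitian := Matrix.isHermitian_one.sub hA
  refine hB.posSemidef_iff_eigenvalues_nonneg.mpr fun i => ?_
  have hmem : (1 - hB.eigenvalues i) ∈ spectrum ℝ A := by
    have h := hB.eigenvalues_mem_spectrum_real i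
    rw [spectrum.mem_iff] at h ⊢
    have hneg : algebraMap ℝ (Matrix n n ℝ) (1 - hB.eigenvalues i) - A =
        -(algebraMap ℝ (Matrix n n ℝ) (hB.eigenvalues i) - (1 - A)) := by
      rw [map_sub, map_one]
      abel
    rwa [hneg, IsUnit.neg_iff]
  have hle : (‖1 - hB.eigenvalues i‖₊ : ENNReal) ≤ 1 :=
    (le_iSup₂ (f := fun k (_ : k ∈ spectrum ℝ A) => (‖k‖₊ : ENNReal)) _ hmem).trans hρ
  have hnorm : ‖1 - hB.eigenvalues i‖ ≤ 1 := by exact_mod_cast hle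
  rw [Real.norm_eq_abs, abs_le] at hnorm
  simp only [Pi.zero_apply]
  linarith [hnorm.2]

/-- A weighted harmonic-mean bound, from Cauchy-Schwarz. -/
theorem lt_of_mul_lt_mul_add_four_mul {u x N D : ℝ} (hu : 0 ≤ u) (hN : 0 < N) (hD : 0 < D)
    (hx : 0 < x) (h : x * ((1 + 2 * u) * D + 4 * u * N) < (1 + u) * N * D) :
    4 * x < (4 * N + D) * (1 + 3 * u - 2 * √((1 + 2 * u) * u)) / (1 + u) := by
  have h1 : 0 ≤ 1 + 2 * u := by linarith
  rw [Real.sqrt_mul h1]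
  obtain ⟨p, hp⟩ : ∃ p, p = √(1 + 2 * u) := ⟨_, rfl⟩
  obtain ⟨q, hq⟩ : ∃ q, q = √u := ⟨_, rfl⟩
  have hp2 : p ^ 2 = 1 + 2 * u := by rw [hp, Real.sq_sqrt h1]
  have hq2 : q ^ 2 = u := by rw [hq, Real.sq_sqrt hu]
  have hp0 : 0 < p := by rw [hp]; exact Real.sqrt_pos.mpr (by linarith)
  have hq0 : 0 ≤ q := by rw [hq]; exact Real.sqrt_nonneg u
  rw [← hp, ← hq, lt_div_iff₀ (by linarith)]
  have hqp : q < p := by nlinarith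
  have hcs : 4 * N * D * (p + q) ^ 2 ≤ (4 * N + D) * (p ^ 2 * D + 4 * q ^ 2 * N) := by
    nlinarith [sq_nonneg (p * D - 4 * q * N)]
  have hK : 4 * x * (p + q) ^ 2 < (4 * N + D) * (1 + u) := by
    rw [← hp2, ← hq2] at h
    have hu' : 0 ≤ 1 + q ^ 2 := by positivity
    have hND : 0 < N * D := mul_pos hN hD
    refine lt_of_mul_lt_mul_right (a := N * D) ?_ hND.le
    calc 4 * x * (p + q) ^ 2 * (N * D) = x * (4 * N * D * (p + q) ^ 2) := by ring
      _ ≤ x * ((4 * N + D) * (p ^ 2 * D + 4 * q ^ 2 * N)) := by gcongr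
      _ = (4 * N + D) * (x * (p ^ 2 * D + 4 * q ^ 2 * N)) := by ring
      _ < (4 * N + D) * ((1 + q ^ 2) * N * D) := by gcongr
      _ = (4 * N + D) * (1 + u) * (N * D) := by rw [hq2]; ring
  have hprod : (p + q) * (p - q) = 1 + u := by linear_combination hp2 - hq2
  have hsq : 1 + 3 * u - 2 * (p * q) = (p - q) ^ 2 := by linear_combination -hp2 - hq2
  have hpos : 0 < (p - q) ^ 2 := by have := sub_pos.mpr hqp; positivity
  rw [hsq]
  refine lt_of_mul_lt_mul_right (a := 1 + u) ?_ (by linarith)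
  calc 4 * x * (1 + u) * (1 + u) = 4 * x * (p + q) ^ 2 * (p - q) ^ 2 := by
        rw [← hprod]; ring
    _ < (4 * N + D) * (1 + u) * (p - q) ^ 2 := by gcongr
    _ = (4 * N + D) * (p - q) ^ 2 * (1 + u) := by ring

/-- Pattern H: if `ρ(A) ≤ 1`, `a24 > √(1-2s)/2`, `a45 > √(1-2s)/2` and
`a12 > √(2(t+s)S2/(4a45²+2s-1))/2`, then a sharper upper bound on `a24` and a
sharper lower bound on `a45` hold. -/
theorem stmt_8
    (s t a12 a13 a24 a25 a35 a45 : ℝ)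
    (hs : 0 ≤ s) (ht : 0 ≤ t) (h12n : 0 ≤ a12) (h13n : 0 ≤ a13)
    (h24n : 0 ≤ a24) (h25n : 0 ≤ a25) (h35n : 0 ≤ a35) (h45n : 0 ≤ a45)
    (hts : t + s ≤ 1/2)
    (A : Matrix (Fin 5) (Fin 5) ℝ)
    (hA : A = !![1/2 - t - s, a12, a13, 0, 0;
                 a12, 0, 0, a24, a25;
                 a13, 0, t, 0, a35;
                 0, a24, 0, s, a45;
                 0, a25, a35, a45, 0])
    (S2 : ℝ) (hS2 : S2 = -1 + 2*s + 4*a24^2 + 4*(1 - 2*s)*a25^2 + 4*a45^2 + 16*a24*a25*a45)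
    (hρ : spectralRadius ℝ A ≤ 1)
    (h24 : a24 > 1/2 * Real.sqrt (1 - 2*s))
    (h45 : a45 > 1/2 * Real.sqrt (1 - 2*s))
    (h12 : a12 > 1/2 * Real.sqrt (2 * (t + s) * S2 / (4*a45^2 + 2*s - 1))) :
    a24 < 1/2 * Real.sqrt ((3 - 2*s) * (1 + 3*t + 3*s -
        2 * Real.sqrt ((1 + 2*t + 2*s) * (t + s))) / (1 + t + s)) ∧
    a45 > Real.sqrt ((1 - s)/2 -
        1/4 * Real.sqrt (1 - (1 - 2*s) * (3 - 2*s) * (t + s) / (1 + t + s))) := by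
  have hs2 : 0 ≤ 1 - 2 * s := by linarith
  have hHerm : A.IsHermitian := by
    rw [Matrix.IsHermitian, hA]
    ext i j
    fin_cases i <;> fin_cases j <;> simp
  have hpsd := hHerm.posSemidef_one_sub_of_spectralRadius_le_one hρ
  have h3 := (hpsd.submatrix ![(1 : Fin 5), 3, 4]).det_nonneg
  have h4 := (hpsd.submatrix ![(0 : Fin 5), 1, 3, 4]).det_nonneg
  obtain ⟨M, hM⟩ : ∃ M, M = 1 - s - a45 ^ 2 - a24 ^ 2 - (1 - s) * a25 ^ 2
      - 2 * a24 * a25 * a45 := ⟨_, rfl⟩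
  obtain ⟨N, hN⟩ : ∃ N, N = 1 - s - a45 ^ 2 := ⟨_, rfl⟩
  obtain ⟨D, hD⟩ : ∃ D, D = 4 * a45 ^ 2 + 2 * s - 1 := ⟨_, rfl⟩
  obtain ⟨u, hu⟩ : ∃ u, u = t + s := ⟨_, rfl⟩
  have hM0 : 0 ≤ M := by
    rw [hM]
    refine le_of_le_of_eq h3 ?_
    rw [Matrix.det_fin_three, hA]
    simp
    ring
  have hdet : 0 ≤ (1 / 2 + u) * M - a12 ^ 2 * N := by
    rw [hM, hN, hu]
    refine le_of_le_of_eq h4 ?_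
    have hsub : (1 - A).submatrix ![(0 : Fin 5), 1, 3, 4] ![(0 : Fin 5), 1, 3, 4] =
        !![1 / 2 + t + s, -a12, 0, 0; -a12, 1, -a24, -a25; 0, -a24, 1 - s, -a45;
          0, -a25, -a45, 1] := by
      rw [hA]
      ext i j
      fin_cases i <;> fin_cases j <;> simp
      ring
    rw [hsub, Matrix.det_succ_row_zero]
    simp [Fin.sum_univ_succ, Matrix.det_fin_three, Fin.succAbove]
    ring
  have hu0 : 0 ≤ u := by linarith
  have hx0 : 0 < a24 := lt_of_le_of_lt (by positivity) h24
  have hy0 : 0 < a45 := lt_of_le_of_lt (by positivity) h45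
  have hx : 1 - 2 * s < 4 * a24 ^ 2 := by
    have h := (Real.sqrt_lt' (by linarith : 0 < 2 * a24)).mp (by linarith : √(1 - 2 * s) < 2 * a24)
    linarith
  have hD0 : 0 < D := by
    have h := (Real.sqrt_lt' (by linarith : 0 < 2 * a45)).mp (by linarith : √(1 - 2 * s) < 2 * a45)
    linarith
  have hprod : 0 ≤ a24 * a25 * a45 := by positivity
  have hN0 : 0 < N := by
    have : 0 ≤ (1 - s) * a25 ^ 2 := mul_nonneg (by linarith) (sq_nonneg _)
    have : 0 < a24 ^ 2 := by positivity
    linarith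
  have h12pos : 0 < a12 := lt_of_le_of_lt (by positivity) h12
  have h12sq : 2 * u * S2 < 4 * a12 ^ 2 * D := by
    rw [← hu, ← hD] at h12
    have h := (Real.sqrt_lt' (by linarith : 0 < 2 * a12)).mp
      (by linarith : √(2 * u * S2 / D) < 2 * a12)
    rw [div_lt_iff₀ hD0] at h
    linarith
  have hkey : u * S2 * N < (1 + 2 * u) * M * D := by
    have h1 := mul_lt_mul_of_pos_right h12sq hN0
    have h2 := mul_nonneg hdet hD0.le
    linarith
  have hMle : M ≤ N - a24 ^ 2 := by
    have : 0 ≤ (1 - s) * a25 ^ 2 := mul_nonneg (by linarith) (sq_nonneg _)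
    linarith
  have hSge : 4 * a24 ^ 2 + D ≤ S2 := by
    have : 0 ≤ (1 - 2 * s) * a25 ^ 2 := mul_nonneg hs2 (sq_nonneg _)
    linarith
  have hmain : a24 ^ 2 * ((1 + 2 * u) * D + 4 * u * N) < (1 + u) * N * D := by
    have h1 : u * (4 * a24 ^ 2 + D) * N ≤ u * S2 * N := by gcongr
    have h2 : (1 + 2 * u) * M * D ≤ (1 + 2 * u) * (N - a24 ^ 2) * D := by gcongr
    linarith
  have hND : 4 * N + D = 3 - 2 * s := by rw [hN, hD]; ring
  constructor
  · have h := lt_of_mul_lt_mul_add_four_mul hu0 hN0 hD0 (by positivity) hmain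
    rw [hND, hu] at h
    have h' : 2 * a24 < √((3 - 2 * s) * (1 + 3 * t + 3 * s -
        2 * √((1 + 2 * t + 2 * s) * (t + s))) / (1 + t + s)) := by
      refine Real.lt_sqrt_of_sq_lt ?_
      rw [show 1 + 3 * t + 3 * s = 1 + 3 * (t + s) by ring,
        show 1 + 2 * t + 2 * s = 1 + 2 * (t + s) by ring, add_assoc 1 t s]
      linarith
    linarith
  · refine (Real.sqrt_lt' hy0).mpr ?_
    have hquad : (1 - D) ^ 2 < 1 - (1 - 2 * s) * (3 - 2 * s) * (t + s) / (1 + t + s) := by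
      have hle : (1 - 2 * s) * ((1 + 2 * u) * D + 4 * u * N) ≤
          4 * a24 ^ 2 * ((1 + 2 * u) * D + 4 * u * N) := by gcongr
      rw [add_assoc 1 t s, ← hu, lt_sub_comm, div_lt_iff₀ (by linarith)]
      have hN' : N = (3 - 2 * s - D) / 4 := by linarith
      rw [hN'] at hle hmain
      linarith
    have h := Real.lt_sqrt_of_sq_lt hquad
    linarith
end

section
/- Assume t ≤ 1/2 − t − s, t + s > 0, and the following inequalities: S1 ≥ 0; a12 ≤ (1/2)·√(2(1 + 2t + 2s)·S1 / (1 − s − a45²)); a35 ≤ √((1 − t)·S1 / (1 − s − a24²)); a24 > (1/2)·√(1 − 2s); a45 > (1/2)·√(1 − 2s); a25 < 1/(2(1 − s)); a12 > (1/2)·√(2(t + s)·S2 / (4·a45² + 2s − 1)); a45 > √((1 − s)/2 − (1/4)·√(1 − (1 − 2s)(3 − 2s)(t + s)/(1 + t + s))); a35 > (1/2)·√((1 − 2t)·S2 / (4·a24² + 2s − 1)); a45 < (1/2)·√((3 − 2s)(5 − 6t − 4√((1 − t)(1 − 2t))) / (3 − 2t)); and a13 > (1/2)·√(2(1 − 2t)(t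 + s)). Then ρ(A′) > 1, where A′ is the 4×4 principal submatrix of A obtained by deleting the fourth row and fourth column. -/
/-- A quadratic polynomial in `X` and `Y` is nonnegative for `0 ≤ Y ≤ 2` once the coefficients of its
discriminant in `X` have suitable signs. -/
theorem quadratic_nonneg_of_coeffs {x2 xy x1 y2 y1 c0 e X Y : ℝ} (hx2 : 0 < x2) (he : 0 ≤ e)
    (hY : 0 ≤ Y) (hY2 : Y ≤ 2) (h2 : -e ≤ 4*x2*y2 - xy^2) (h1 : 2*e ≤ 4*x2*y1 - 2*xy*x1)
    (h0 : 0 ≤ 4*x2*c0 - x1^2) :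
    0 ≤ x2*X^2 + xy*X*Y + x1*X + y2*Y^2 + y1*Y + c0 := by
  have key : 0 ≤ 4*x2*(x2*X^2 + xy*X*Y + x1*X + y2*Y^2 + y1*Y + c0) := by
    have h1 : 0 ≤ Y^2*(4*x2*y2 - xy^2 + e) := mul_nonneg (sq_nonneg _) (by linarith)
    have h2 : 0 ≤ Y*(4*x2*y1 - 2*xy*x1 - 2*e) := mul_nonneg hY (by linarith)
    have h3 : 0 ≤ e*(Y*(2-Y)) := mul_nonneg he (mul_nonneg hY (by linarith))
    linarith [sq_nonneg (2*x2*X + xy*Y + x1)]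
  exact nonneg_of_mul_nonneg_right key (by linarith)

/-- The determinant inequality comparing the bounds on `a12`, `a13`, `a35`, in terms of `v = 1 - 2s`, `X = 4 a24² - v`,
`Y = 4 a45² - v`. -/
theorem determinant_bound {v t X Y : ℝ} (hv : v ≤ 1) (ht : 0 ≤ t) (htv : 4 * t ≤ v) (hX : 0 ≤ X) (hY : 0 ≤ Y)
    (hXY : X + Y ≤ 2)
    (hF : (1 - 2*t) * (X + Y + v) * (2 - X + v) ≤ 4 * (1 - t) * (2 - X - Y) * X) :
    ((1 + ((1 - v)/2 + t)) * Y - ((1 - v)/2 + t) * (X + v)) *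
      ((3 - 2*t) * X - (1 - 2*t) * (Y + v)) ≤ 4 * ((1 - v)/2 + t) * (1 - 2*t) * X * Y := by
  have hv0 : 0 ≤ v := by linarith
  have htw : 0 ≤ t * (v - 4*t) := mul_nonneg ht (by linarith)
  have htv0 : 0 ≤ t * v := mul_nonneg ht hv0
  have hv1 : 0 ≤ 1 - v := by linarith
  have hR := quadratic_nonneg_of_coeffs (X := X) (Y := Y)
    (x2 := (3 - 2*t) * (1/2 - v/6 + t))
    (xy := -((1+((1 - v)/2 + t))*(3-2*t) - 3*((1 - v)/2 + t)*(1-2*t)) + v/3*(3-2*t))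
    (x1 := 2*((1 - v)/2 + t)*v - 2*(v/3)*(3-2*t))
    (y2 := (1+((1 - v)/2 + t))*(1-2*t))
    (y1 := (1-2*t)*v + v/3*(1-2*t)*(2+v))
    (c0 := -((1 - v)/2 + t)*(1-2*t)*v^2 + v/3*(1-2*t)*(2*v+v^2)) (e := t * v / 9)
    (mul_pos (by linarith) (by linarith)) (by positivity) hY (by linarith)
    (by
      have h1 : 0 ≤ t * (v - 4*t) * (3 - v) := mul_nonneg htw (by linarith)
      have h2 : 0 ≤ t * v * (1 - v) := mul_nonneg htv0 hv1
      have h3 : 0 ≤ t * (v - 4*t) * v^2 := mul_nonneg htw (sq_nonneg _)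
      have h4 : 0 ≤ t * v * (1 - v) * v := mul_nonneg h2 hv0
      linarith)
    (by
      have h1 : 0 ≤ v * (1 - v) * (3 - v) := by
        apply mul_nonneg (mul_nonneg hv0 hv1); linarith
      have h2 : 0 ≤ v * (t * (v - 4*t)) * (432 + 264*v + 8*v^2) := by positivity
      have h3 : 0 ≤ t * v * (1 - v) * (104 + 28 * v + 2 * v^2) := by positivity
      have h4 : 0 ≤ t^3 * v * (480 + 48*v) := by positivity
      nlinarith)
    (by
      have h1 : 0 ≤ v^2 * (v * (1 - v)) := by positivity
      have h2 : 0 ≤ v^2 * (t * (v - 4*t)) * (100 + 232*v + 20*v^2) := by positivity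
      have h3 : 0 ≤ v^2 * (t * v) * ((1 - v) * (23 + 5 * v) + 8) := by positivity
      have h4 : 0 ≤ t^2 * v^2 * (t * (v - 4*t)) := by positivity
      have h5 : 0 ≤ t^3 * v^2 := by positivity
      have h6 : 0 ≤ t^3 * v^3 := by positivity
      nlinarith)
  have hk : 0 ≤ v/3*(4 * (1 - t) * (2 - X - Y) * X - (1 - 2*t) * (X + Y + v) * (2 - X + v)) :=
    mul_nonneg (by linarith) (by linarith)
  linarith

theorem one_lt_spectralRadius_of_dotProduct_lt {n : Type*} [Fintype n] [DecidableEq n]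
    {M : Matrix n n ℝ} (hM : M.IsHermitian) (x : n → ℝ)
    (hx : x ⬝ᵥ x < x ⬝ᵥ M.mulVec x) : 1 < spectralRadius ℝ M := by
  by_contra! h
  have hps : (1 - M).PosSemidef := by
    rw [Matrix.posSemidef_iff_isHermitian_and_spectrum_nonneg]
    refine ⟨Matrix.isHermitian_one.sub hM, fun r hr => ?_⟩
    have hmem : 1 - r ∈ spectrum ℝ M := by
      rw [← map_one (algebraMap ℝ (Matrix n n ℝ)), ← spectrum.singleton_sub_eq] at hr
      obtain ⟨_, rfl, k, hk, rfl⟩ := hr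
      simpa using hk
    have hle : (‖1 - r‖₊ : ENNReal) ≤ 1 :=
      (le_iSup₂ (f := fun k (_ : k ∈ spectrum ℝ M) => (‖k‖₊ : ENNReal)) (1 - r) hmem).trans h
    have hn : ‖1 - r‖ ≤ 1 := by exact_mod_cast hle
    have := (le_abs_self _).trans hn
    simp only [Set.mem_ofPred_eq]
    linarith
  have := hps.dotProduct_mulVec_nonneg x
  simp only [star_trivial, Matrix.sub_mulVec, Matrix.one_mulVec, dotProduct_sub] at this
  linarith

/-- A binary quadratic form whose matrix has a negative off-diagonal entry `-b` and is not
positive semidefinite takes a negative value at a nonnegative vector. -/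
theorem exists_nonneg_quadratic_neg {P Q b : ℝ} (hb : 0 < b)
    (h : 0 < P → 0 < Q → P * Q < b^2) :
    ∃ x y : ℝ, 0 ≤ x ∧ 0 ≤ y ∧ P * x^2 + Q * y^2 - 2 * b * x * y < 0 := by
  by_cases hQ : 0 < Q
  · refine ⟨Q, b, hQ.le, hb.le, ?_⟩
    have : P * Q < b^2 := by
      by_cases hP : 0 < P
      · exact h hP hQ
      · nlinarith [mul_nonneg (not_lt.1 hP |> neg_nonneg.2) hQ.le, pow_pos hb 2]
    nlinarith [mul_pos hQ (sub_pos.2 this)]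
  · by_cases hP : 0 < P
    · refine ⟨b, P, hb.le, hP.le, ?_⟩
      have : P * Q < b^2 := by
        nlinarith [mul_nonneg (not_lt.1 hQ |> neg_nonneg.2) hP.le, pow_pos hb 2]
      nlinarith [mul_pos hP (sub_pos.2 this)]
    · exact ⟨1, 1, zero_le_one, zero_le_one, by linarith⟩

theorem div_four_lt_sq_of_half_sqrt_lt {r y : ℝ} (h : 1/2 * √r < y) : r / 4 < y^2 := by
  have := Real.lt_sq_of_sqrt_lt (show √r < 2 * y by linarith)
  linarith

/-- Pattern H: under the listed inequalities the principal 4×4 submatrix of `A`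
obtained by deleting the fourth row and column has spectral radius larger
than 1. -/
theorem stmt_9
    (s t a12 a13 a24 a25 a35 a45 : ℝ)
    (hs : 0 ≤ s) (ht : 0 ≤ t) (h12n : 0 ≤ a12) (h13n : 0 ≤ a13)
    (h24n : 0 ≤ a24) (h25n : 0 ≤ a25) (h35n : 0 ≤ a35) (h45n : 0 ≤ a45)
    (hts : t + s ≤ 1/2)
    (A : Matrix (Fin 5) (Fin 5) ℝ)
    (hA : A = !![1/2 - t - s, a12, a13, 0, 0;
                 a12, 0, 0, a24, a25;
                 a13, 0, t, 0, a35;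
                 0, a24, 0, s, a45;
                 0, a25, a35, a45, 0])
    (S1 : ℝ) (hS1 : S1 = 1 - s - a24^2 - (1 - s) * a25^2 - a45^2 - 2 * a24 * a25 * a45)
    (S2 : ℝ) (hS2 : S2 = -1 + 2*s + 4*a24^2 + 4*(1 - 2*s)*a25^2 + 4*a45^2 + 16*a24*a25*a45)
    (htt : t ≤ 1/2 - t - s)
    (htspos : 0 < t + s)
    (hS1nn : S1 ≥ 0)
    (h12ub : a12 ≤ 1/2 * Real.sqrt (2 * (1 + 2*t + 2*s) * S1 / (1 - s - a45^2)))
    (h35ub : a35 ≤ Real.sqrt ((1 - t) * S1 / (1 - s - a24^2)))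
    (h24lb : a24 > 1/2 * Real.sqrt (1 - 2*s))
    (h45lb : a45 > 1/2 * Real.sqrt (1 - 2*s))
    (h25ub : a25 < 1 / (2 * (1 - s)))
    (h12lb : a12 > 1/2 * Real.sqrt (2 * (t + s) * S2 / (4*a45^2 + 2*s - 1)))
    (h45lb2 : a45 > Real.sqrt ((1 - s)/2 -
        1/4 * Real.sqrt (1 - (1 - 2*s) * (3 - 2*s) * (t + s) / (1 + t + s))))
    (h35lb : a35 > 1/2 * Real.sqrt ((1 - 2*t) * S2 / (4*a24^2 + 2*s - 1)))
    (h45ub : a45 < 1/2 * Real.sqrt ((3 - 2*s) * (5 - 6*t -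
        4 * Real.sqrt ((1 - t) * (1 - 2*t))) / (3 - 2*t)))
    (h13lb : a13 > 1/2 * Real.sqrt (2 * (1 - 2*t) * (t + s))) :
    1 < spectralRadius ℝ (A.submatrix ![0, 1, 2, 4] ![0, 1, 2, 4]) := by
  have hA2 : (1 - 2*s) / 4 < a24^2 := div_four_lt_sq_of_half_sqrt_lt h24lb
  have hB2 : (1 - 2*s) / 4 < a45^2 := div_four_lt_sq_of_half_sqrt_lt h45lb
  have ha2 := div_four_lt_sq_of_half_sqrt_lt h12lb
  have hd2 := div_four_lt_sq_of_half_sqrt_lt h35lb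
  have hb2 := div_four_lt_sq_of_half_sqrt_lt h13lb
  have hb : 0 < a13 := lt_of_le_of_lt (by positivity) h13lb
  obtain ⟨v, hv⟩ : ∃ v, v = 1 - 2*s := ⟨_, rfl⟩
  obtain ⟨X, hX⟩ : ∃ X, X = 4*a24^2 - v := ⟨_, rfl⟩
  obtain ⟨Y, hY⟩ : ∃ Y, Y = 4*a45^2 - v := ⟨_, rfl⟩
  have hv0 : 0 ≤ v := by linarith
  have hX0 : 0 < X := by linarith
  have hY0 : 0 < Y := by linarith
  have hc1 : 0 ≤ a24 * a25 * a45 := by positivity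
  have hc2 : 0 ≤ v * a25^2 := by positivity
  have hc3 : 0 ≤ (1 - s) * a25^2 := mul_nonneg (by linarith) (sq_nonneg _)
  have hS2X : X + Y + v ≤ S2 := by rw [hv] at *; linarith
  have hS1X : 4 * S1 ≤ 2 - X - Y := by linarith
  have hden : 0 < 1 - s - a24^2 := by linarith
  have hd0 : 0 < 1 - 2*t := by linarith
  rw [show 4*a45^2 + 2*s - 1 = Y by linarith, div_div, div_lt_iff₀ (by positivity)] at ha2
  rw [show 4*a24^2 + 2*s - 1 = X by linarith, div_div, div_lt_iff₀ (by positivity)] at hd2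
  have ha2' : (t + s) * (X + Y + v) < 2 * Y * a12^2 := by
    have := mul_le_mul_of_nonneg_left hS2X htspos.le
    linarith
  have hd2' : (1 - 2*t) * (X + Y + v) < 4 * X * a35^2 := by
    have := mul_le_mul_of_nonneg_left hS2X hd0.le
    linarith
  have hd2'' : a35^2 * (2 - X + v) ≤ (1 - t) * (2 - X - Y) := by
    have hnn : 0 ≤ (1 - t) * S1 / (1 - s - a24^2) :=
      div_nonneg (mul_nonneg (by linarith) hS1nn) hden.le
    have h1 : a35^2 ≤ (1 - t) * S1 / (1 - s - a24^2) :=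
      (Real.le_sqrt h35n hnn).1 h35ub
    rw [le_div_iff₀ hden] at h1
    have h2 : (1 - t) * (4 * S1) ≤ (1 - t) * (2 - X - Y) :=
      mul_le_mul_of_nonneg_left hS1X (by linarith)
    have h3 : 2 - X + v = 4 * (1 - s - a24^2) := by linarith
    rw [h3]
    linarith
  have hF : (1 - 2*t) * (X + Y + v) * (2 - X + v) ≤ 4 * (1 - t) * (2 - X - Y) * X := by
    have h1 : (1 - 2*t) * (X + Y + v) * (2 - X + v) ≤ 4 * X * a35^2 * (2 - X + v) :=
      mul_le_mul_of_nonneg_right hd2'.le (by linarith)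
    have h2 := mul_le_mul_of_nonneg_left hd2'' (show 0 ≤ 4 * X by linarith)
    linarith
  have hG := determinant_bound (by linarith) ht (by linarith) hX0.le hY0.le (by linarith) hF
  rw [show (1 - v)/2 + t = t + s by linarith] at hG
  obtain ⟨x, y, hx, hy, hxy⟩ := exists_nonneg_quadratic_neg
    (P := 1/2 + t + s - a12^2) (Q := 1 - t - a35^2) hb (by
      intro hP hQ
      have hP' : 2 * Y * (1/2 + t + s - a12^2) < (1 + (t + s)) * Y - (t + s) * (X + v) := by
        linarith
      have hQ' : 4 * X * (1 - t - a35^2) < (3 - 2*t) * X - (1 - 2*t) * (Y + v) := by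
        linarith
      have h1 := mul_lt_mul'' hP' hQ' (by positivity) (by positivity)
      have hXY : 0 < 8 * (X * Y) := by positivity
      have h2 := mul_lt_mul_of_pos_left hb2 hXY
      exact lt_of_mul_lt_mul_left (by linarith) hXY.le)
  have hM : A.submatrix ![0, 1, 2, 4] ![0, 1, 2, 4] =
      !![1/2 - t - s, a12, a13, 0;
         a12, 0, 0, a25;
         a13, 0, t, a35;
         0, a25, a35, 0] := by
    rw [hA]
    ext i j
    fin_cases i <;> fin_cases j <;> rfl
  rw [hM]
  refine one_lt_spectralRadius_of_dotProduct_lt ?_ ![x, a12 * x, y, a35 * y] ?_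
  · ext i j
    fin_cases i <;> fin_cases j <;> rfl
  · have h1 : 0 ≤ a25 * (a12 * x) * (a35 * y) := by positivity
    simp only [dotProduct, Matrix.mulVec, Fin.sum_univ_four, Matrix.of_apply, Matrix.cons_val]
    linarith
end

section
/- If ρ(A) ≤ 1 then λ3 ≤ 1/2. -/
lemma rational_bound {s w : ℝ} (hs0 : 0 ≤ s) (hs1 : s ≤ 1) (hw : 0 ≤ w) (hsw : s ≤ w ^ 2) :
    (3 + s) ^ 2 * (4 * s + 6 * s ^ 2 - 2 * s ^ 3 - w ^ 2 * (8 - 12 * s + 3 * s ^ 2)) ≤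
      (2 - s) ^ 2 * (w ^ 2 * (4 * (1 + w) ^ 2 * (2 + s) + 4 * (1 + w) * (3 + s) * (2 + w))) := by
  have hws : s ≤ w := by nlinarith
  have h1 : 4 * s + 6 * s ^ 2 - 2 * s ^ 3 - w ^ 2 * (8 - 12 * s + 3 * s ^ 2) ≤
      w ^ 2 * (18 * s - 4 - 5 * s ^ 2) := by
    nlinarith [mul_nonneg (sub_nonneg.2 hsw) (by nlinarith : 0 ≤ 4 + 6 * s - 2 * s ^ 2)]
  have h2 : (3 + s) ^ 2 * (18 * s - 4 - 5 * s ^ 2) ≤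
      (2 - s) ^ 2 * (4 * (1 + s) ^ 2 * (2 + s) + 4 * (1 + s) * (3 + s) * (2 + s)) := by
    have : 0 ≤ 1 - s := by linarith
    nlinarith [mul_nonneg hs0 this, pow_nonneg this 2, pow_nonneg this 3, pow_nonneg this 4,
      pow_nonneg this 5, mul_nonneg hs0 (pow_nonneg this 2), mul_nonneg hs0 (pow_nonneg this 3),
      mul_nonneg (pow_nonneg hs0 2) this, mul_nonneg (pow_nonneg hs0 3) this,
      mul_nonneg (pow_nonneg hs0 4) this]
  have h3 : 4 * (1 + s) ^ 2 * (2 + s) + 4 * (1 + s) * (3 + s) * (2 + s) ≤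
      4 * (1 + w) ^ 2 * (2 + s) + 4 * (1 + w) * (3 + s) * (2 + w) := by gcongr
  calc _ ≤ (3 + s) ^ 2 * (w ^ 2 * (18 * s - 4 - 5 * s ^ 2)) := by gcongr
    _ = w ^ 2 * ((3 + s) ^ 2 * (18 * s - 4 - 5 * s ^ 2)) := by ring
    _ ≤ w ^ 2 * ((2 - s) ^ 2 * (4 * (1 + s) ^ 2 * (2 + s) + 4 * (1 + s) * (3 + s) * (2 + s))) := by
        gcongr
    _ ≤ w ^ 2 * ((2 - s) ^ 2 * (4 * (1 + w) ^ 2 * (2 + s) + 4 * (1 + w) * (3 + s) * (2 + w))) := by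
        gcongr
    _ = _ := by ring

lemma concave_bound {S w P q κ : ℝ} (hS1 : 1 ≤ S) (hS2 : S ≤ 2) (hw : 0 ≤ w)
    (hSw : S - 1 ≤ w ^ 2) (hwS : 2 * w ≤ S) (hP : 0 ≤ P) (hq : 0 < q) (hκ : κ * (3 - S) = 1)
    (hW : w ^ 2 * (P + q) ^ 2 ≤ (1 + S + w ^ 2) * q ^ 2) :
    P ^ 2 * (4 * κ ^ 2 * (1 + S + w ^ 2) - 2 * S - 3 * w ^ 2) ≤
      q ^ 2 * (1 + S) + 2 * P * q * w * (2 + w) := by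
  set N := 4 * κ ^ 2 * (1 + S + w ^ 2) - 2 * S - 3 * w ^ 2 with hN
  have hR : 0 ≤ q ^ 2 * (1 + S) + 2 * P * q * w * (2 + w) := by positivity
  rcases le_or_gt N 0 with hN0 | hN0
  · nlinarith [sq_nonneg P]
  have hv : (2 + S) ^ 2 * N ≤
      w ^ 2 * (4 * (1 + w) ^ 2 * (1 + S) + 4 * (1 + w) * (2 + S) * (2 + w)) := by
    have h := rational_bound (s := S - 1) (by linarith) (by linarith) hw hSw
    have e : (3 - S) ^ 2 * N = 4 * (S - 1) + 6 * (S - 1) ^ 2 - 2 * (S - 1) ^ 3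
        - w ^ 2 * (8 - 12 * (S - 1) + 3 * (S - 1) ^ 2) := by
      have : (3 - S) ^ 2 * N = 4 * (κ * (3 - S)) ^ 2 * (1 + S + w ^ 2)
        - (3 - S) ^ 2 * (2 * S + 3 * w ^ 2) := by rw [hN]; ring
      rw [this, hκ]; ring
    rw [← e] at h
    have h3 : 0 < (3 - S) ^ 2 := by have : 0 < 3 - S := by linarith
                                    positivity
    refine le_of_mul_le_mul_left ?_ h3
    nlinarith [h]
  have hw0 : 0 < w := by
    rcases hw.eq_or_lt with h | h
    · subst h
      nlinarith [show 0 < (2 + S) ^ 2 by positivity]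
    · exact h
  have hb : 2 * (1 + w) * (w * P) ≤ (2 + S) * q := by
    have h1 : (2 * (1 + w) * (w * (P + q))) ^ 2 ≤ ((2 + S + 2 * w + 2 * w ^ 2) * q) ^ 2 := by
      have : 4 * (1 + w) ^ 2 * (1 + S + w ^ 2) ≤ (2 + S + 2 * w + 2 * w ^ 2) ^ 2 := by
        nlinarith [sq_nonneg (S - 2 * w)]
      calc _ = 4 * (1 + w) ^ 2 * (w ^ 2 * (P + q) ^ 2) := by ring
        _ ≤ 4 * (1 + w) ^ 2 * ((1 + S + w ^ 2) * q ^ 2) := by gcongr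
        _ = (4 * (1 + w) ^ 2 * (1 + S + w ^ 2)) * q ^ 2 := by ring
        _ ≤ (2 + S + 2 * w + 2 * w ^ 2) ^ 2 * q ^ 2 := by gcongr
        _ = _ := by ring
    have h2 := le_of_sq_le_sq h1 (by positivity)
    nlinarith [h2]
  set T := (2 + S) * q with hT
  set U := 2 * (1 + w) * w * P with hU
  have hUT : U ≤ T := by rw [hU]; linarith
  have hU0 : 0 ≤ U := by positivity
  have hc : 0 < 4 * (1 + w) ^ 2 * w ^ 2 * (2 + S) ^ 2 := by positivity
  refine le_of_mul_le_mul_left ?_ hc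
  calc _ = U ^ 2 * ((2 + S) ^ 2 * N) := by rw [hU]; ring
    _ ≤ U ^ 2 * (w ^ 2 * (4 * (1 + w) ^ 2 * (1 + S) + 4 * (1 + w) * (2 + S) * (2 + w))) := by gcongr
    _ = (4 * w ^ 2 * (1 + w) ^ 2 * (1 + S)) * (U * U)
        + (4 * w ^ 2 * (1 + w) * (2 + S) * (2 + w)) * (U * U) := by ring
    _ ≤ (4 * w ^ 2 * (1 + w) ^ 2 * (1 + S)) * (T * T)
        + (4 * w ^ 2 * (1 + w) * (2 + S) * (2 + w)) * (U * T) := by gcongr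
    _ = _ := by rw [hT, hU]; ring

lemma path_bound {p q r α β κ E F : ℝ} (hp : 0 ≤ p) (hq : 0 < q) (hr : 0 ≤ r)
    (hE0 : 0 ≤ E) (hE1 : E ≤ 1) (hF0 : 0 ≤ F) (hF1 : F ≤ 1) (hEF : 1 ≤ E + F)
    (hα : α * (1 + E) = E) (hβ : β * (1 + F) = F) (hκ : κ * (3 - (E + F)) = 1)
    (hW : α * (p + q) * (β * (q + r)) ≤ q ^ 2) :
    4 * κ ^ 2 * (p * r) ≤ q ^ 2 - α * (p + q) * (β * (q + r))
      + 2 * (p * (β * (q + r)) + r * (α * (p + q))) := by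
  obtain ⟨i, hi, rfl⟩ : ∃ i : ℝ, 0 ≤ i ∧ E = i ^ 2 := ⟨√E, by positivity, by simp [hE0]⟩
  obtain ⟨j, hj, rfl⟩ : ∃ j : ℝ, 0 ≤ j ∧ F = j ^ 2 := ⟨√F, by positivity, by simp [hF0]⟩
  obtain ⟨a, ha, rfl⟩ : ∃ a : ℝ, 0 ≤ a ∧ p = a ^ 2 := ⟨√p, by positivity, by simp [hp]⟩
  obtain ⟨b, hb, rfl⟩ : ∃ b : ℝ, 0 ≤ b ∧ r = b ^ 2 := ⟨√r, by positivity, by simp [hr]⟩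
  have hαβ : 0 < (1 + i ^ 2) * (1 + j ^ 2) := by positivity
  have hprod : (1 + i ^ 2) * (1 + j ^ 2) * (α * (a ^ 2 + q) * (β * (q + b ^ 2))) =
      i ^ 2 * j ^ 2 * ((a ^ 2 + q) * (q + b ^ 2)) := by
    linear_combination (β * (1 + j ^ 2) * (a ^ 2 + q) * (q + b ^ 2)) * hα
      + (i ^ 2 * (a ^ 2 + q) * (q + b ^ 2)) * hβ
  have hW' : i ^ 2 * j ^ 2 * ((a ^ 2 + q) * (q + b ^ 2)) ≤ (1 + i ^ 2) * (1 + j ^ 2) * q ^ 2 := by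
    rw [← hprod]; gcongr
  have hc : (a * b + q) ^ 2 ≤ (a ^ 2 + q) * (q + b ^ 2) := by
    nlinarith [mul_nonneg hq.le (sq_nonneg (a - b))]
  have h := concave_bound (S := i ^ 2 + j ^ 2) (w := i * j) (P := a * b) (q := q) hEF (by linarith)
    (by positivity) (by nlinarith) (by nlinarith [sq_nonneg (i - j)]) (by positivity) hq hκ
    (by nlinarith [mul_le_mul_of_nonneg_left hc (by positivity : 0 ≤ i ^ 2 * j ^ 2)])
  refine le_of_mul_le_mul_left ?_ hαβ
  have e : (1 + i ^ 2) * (1 + j ^ 2) * (q ^ 2 - α * (a ^ 2 + q) * (β * (q + b ^ 2))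
      + 2 * (a ^ 2 * (β * (q + b ^ 2)) + b ^ 2 * (α * (a ^ 2 + q)))) =
      (1 + i ^ 2) * (1 + j ^ 2) * q ^ 2 - i ^ 2 * j ^ 2 * ((a ^ 2 + q) * (q + b ^ 2))
      + 2 * ((1 + i ^ 2) * j ^ 2 * a ^ 2 * (q + b ^ 2)
        + (1 + j ^ 2) * i ^ 2 * b ^ 2 * (a ^ 2 + q)) := by
    linear_combination -hprod + 2 * (1 + i ^ 2) * a ^ 2 * (q + b ^ 2) * hβ
      + 2 * (1 + j ^ 2) * b ^ 2 * (a ^ 2 + q) * hα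
  rw [e]
  nlinarith [h, mul_nonneg hq.le (sq_nonneg (j * a - i * b)),
    mul_nonneg (mul_nonneg hq.le (sq_nonneg (i * j))) (sq_nonneg (a - b))]

lemma le_four_mul_of_sq_le {A B A' B' x y c κ : ℝ} (hx : 0 ≤ x) (hy : 0 ≤ y) (hA' : 0 ≤ A')
    (hB' : 0 ≤ B') (hA : x + A' ≤ 2 * A) (hB : y + B' ≤ 2 * B) (hc : 0 ≤ c) (hκ0 : 0 ≤ κ)
    (hAB : A * B ≤ c ^ 2) (hc' : 4 * κ ^ 2 * c ^ 2 ≤ A' * B') :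
    x * y ≤ 4 * (1 - κ) ^ 2 * (A * B) := by
  have hA0 : 0 ≤ A := by linarith
  have hB0 : 0 ≤ B := by linarith
  set G := √(A * B) with hG
  have hG0 : 0 ≤ G := Real.sqrt_nonneg _
  have hG2 : G ^ 2 = A * B := Real.sq_sqrt (by positivity)
  have hGc : G ≤ c := le_of_sq_le_sq (by rw [hG2]; exact hAB) hc
  set X := √(x * y) with hX
  have hX0 : 0 ≤ X := Real.sqrt_nonneg _
  have hX2 : X ^ 2 = x * y := Real.sq_sqrt (by positivity)
  set Y := √(A' * B') with hY
  have hY0 : 0 ≤ Y := Real.sqrt_nonneg _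
  have hY2 : Y ^ 2 = A' * B' := Real.sq_sqrt (by positivity)
  have hcY : 2 * κ * c ≤ Y := le_of_sq_le_sq (by rw [hY2]; linarith) hY0
  have hXY : X + Y ≤ 2 * G := by
    refine le_of_sq_le_sq ?_ (by positivity)
    have h1 : (x + A') * (y + B') ≤ (2 * A) * (2 * B) := by gcongr
    have h2 : 2 * (X * Y) ≤ x * B' + A' * y := by
      refine le_of_sq_le_sq ?_ (by positivity)
      have : (2 * (X * Y)) ^ 2 = 4 * (x * y) * (A' * B') := by rw [← hX2, ← hY2]; ring
      rw [this]; linarith [sq_nonneg (x * B' - A' * y)]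
    linarith
  have hXG : X ≤ 2 * (1 - κ) * G := by linarith [mul_le_mul_of_nonneg_left hGc hκ0]
  calc x * y = X ^ 2 := hX2.symm
    _ ≤ (2 * (1 - κ) * G) ^ 2 := by gcongr
    _ = 4 * (1 - κ) ^ 2 * G ^ 2 := by ring
    _ = _ := by rw [hG2]

lemma four_mul_sq_le {p q r k κ d1 d3 c W : ℝ} (hp : 0 ≤ p) (hr : 0 ≤ r)
    (hk : 0 ≤ k) (hd1 : 0 ≤ d1) (hd3 : 0 ≤ d3) (hκ0 : 0 ≤ κ) (hκ1 : κ ≤ 1)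
    (hWdef : W = q ^ 2 - d1 * d3) (hW : 0 < W)
    (hc : c = p * r * q / W - k) (hc0 : 0 ≤ c)
    (h : 4 * κ ^ 2 * (p * r) ≤ W + 2 * (p * d3 + r * d1)) :
    4 * κ ^ 2 * c ^ 2 ≤ (p + 2 * (p ^ 2 * d3 / W)) * (r + 2 * (r ^ 2 * d1 / W)) := by
  have hcle : c ≤ p * r * q / W := by linarith
  have hk2 : κ ^ 2 ≤ 1 := pow_le_one₀ hκ0 hκ1
  have hmain : 4 * κ ^ 2 * (p * r) * q ^ 2 ≤ (W + 2 * (p * d3)) * (W + 2 * (r * d1)) := by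
    rw [show q ^ 2 = W + d1 * d3 by rw [hWdef]; ring]
    linarith [mul_le_mul_of_nonneg_left h hW.le,
      mul_le_mul_of_nonneg_right hk2 (by positivity : 0 ≤ p * r * (d1 * d3))]
  calc 4 * κ ^ 2 * c ^ 2 ≤ 4 * κ ^ 2 * (p * r * q / W) ^ 2 := by gcongr
    _ = p * r * (4 * κ ^ 2 * (p * r) * q ^ 2) / W ^ 2 := by field_simp
    _ ≤ p * r * ((W + 2 * (p * d3)) * (W + 2 * (r * d1))) / W ^ 2 := by gcongr
    _ = _ := by field_simp

lemma exists_functional_of_det_nonpos {A B c x y D : ℝ} (hA : 0 < A)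
    (h : A * B < c ^ 2 → D * (A * B - c ^ 2) - A * y ^ 2 - B * x ^ 2 + 2 * c * (x * y) ≤ 0) :
    ∃ b a : ℝ, ∀ y2 y5 y4 : ℝ, b * y5 + a * y4 = 0 →
      0 ≤ A * y2 ^ 2 + 2 * c * (y2 * y5) + B * y5 ^ 2 - 2 * x * (y2 * y4) - 2 * y * (y5 * y4)
        + D * y4 ^ 2 := by
  rcases le_or_gt (c ^ 2) (A * B) with hc | hc
  · refine ⟨0, 1, fun y2 y5 y4 h4 => ?_⟩
    obtain rfl : y4 = 0 := by linarith
    refine nonneg_of_mul_nonneg_right ?_ hA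
    linarith [sq_nonneg (A * y2 + c * y5), mul_nonneg (sub_nonneg.2 hc) (sq_nonneg y5)]
  · refine ⟨c ^ 2 - A * B, -(c * x - A * y), fun y2 y5 y4 h4 => ?_⟩
    have hC : 0 < c ^ 2 - A * B := by linarith
    refine nonneg_of_mul_nonneg_right (a := A * (c ^ 2 - A * B)) ?_ (by positivity)
    have hdet := mul_le_mul_of_nonneg_left (h hc) (by positivity : 0 ≤ A * y4 ^ 2)
    have hz : ((c ^ 2 - A * B) * y5 + -(c * x - A * y) * y4) ^ 2 = 0 := by rw [h4]; ring
    linarith [mul_nonneg hC.le (sq_nonneg (A * y2 + c * y5 - x * y4))]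

lemma det_nonpos_of_le {A B c x y δ D : ℝ} (hA : 0 < A) (hB : 0 < B) (hx : 0 ≤ x) (hy : 0 ≤ y)
    (hδ : 0 ≤ δ) (hD : δ * (x + y) ≤ D) (hc : A * B < c ^ 2)
    (hxy : 0 ≤ c → x * y ≤ 4 * δ ^ 2 * (A * B)) :
    D * (A * B - c ^ 2) - A * y ^ 2 - B * x ^ 2 + 2 * c * (x * y) ≤ 0 := by
  have hD0 : 0 ≤ D := le_trans (by positivity) hD
  rcases lt_or_ge c 0 with hc0 | hc0
  · have h1 := mul_nonneg hD0 (sub_nonneg.2 hc.le)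
    have h2 := mul_nonneg (neg_nonneg.2 hc0.le) (mul_nonneg hx hy)
    have h3 : 0 ≤ A * y ^ 2 := by positivity
    have h4 : 0 ≤ B * x ^ 2 := by positivity
    linarith
  · set G := √(A * B)
    have hG0 : 0 ≤ G := Real.sqrt_nonneg _
    have hG2 : G ^ 2 = A * B := Real.sq_sqrt (by positivity)
    have hGc : G ≤ c := le_of_sq_le_sq (by rw [hG2]; exact hc.le) hc0
    set X := √(x * y)
    have hX0 : 0 ≤ X := Real.sqrt_nonneg _
    have hX2 : X ^ 2 = x * y := Real.sq_sqrt (by positivity)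
    have hXG : X ≤ 2 * δ * G := by
      refine le_of_sq_le_sq ?_ (by positivity)
      rw [hX2, mul_pow, hG2]
      linarith [hxy hc0]
    have hXs : 2 * X ≤ x + y := by
      refine le_of_sq_le_sq ?_ (by positivity)
      rw [mul_pow, hX2]
      linarith [sq_nonneg (x - y)]
    have hS : 2 * G * (x * y) ≤ A * y ^ 2 + B * x ^ 2 := by
      refine le_of_sq_le_sq ?_ (by positivity)
      rw [mul_pow, mul_pow, hG2]
      linarith [sq_nonneg (A * y ^ 2 - B * x ^ 2)]
    have hDG : 2 * (x * y) ≤ D * (c + G) := calc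
      2 * (x * y) = 2 * X * X := by rw [← hX2]; ring
      _ ≤ (x + y) * (2 * δ * G) := by gcongr
      _ = δ * (x + y) * (G + G) := by ring
      _ ≤ D * (c + G) := by gcongr
    rw [← hG2]
    linarith [mul_nonneg (sub_nonneg.2 hGc) (sub_nonneg.2 hDG)]

lemma exists_functionals_house_form_nonpos {p q r x y k α β κ E F d1 d2 d3 d4 d5 : ℝ}
    (hp : 0 ≤ p) (hq : 0 ≤ q) (hr : 0 ≤ r) (hx : 0 ≤ x) (hy : 0 ≤ y) (hk : 0 ≤ k)
    (hE0 : 0 ≤ E) (hE1 : E ≤ 1) (hF0 : 0 ≤ F) (hF1 : F ≤ 1) (hEF : 1 ≤ E + F)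
    (hα : α * (1 + E) = E) (hβ : β * (1 + F) = F) (hκ : κ * (3 - (E + F)) = 1)
    (hd1 : d1 = α * (p + q)) (hd3 : d3 = β * (q + r))
    (hd2 : p + k + x ≤ 2 * d2) (hd20 : 0 < d2) (hd5 : r + k + y ≤ 2 * d5) (hd50 : 0 < d5)
    (hd4 : (1 - κ) * (x + y) ≤ d4) :
    ∃ f g : Fin 5 → ℝ, ∀ w1 w2 w3 w4 w5 : ℝ,
      f ⬝ᵥ ![w1, w2, w3, w4, w5] = 0 → g ⬝ᵥ ![w1, w2, w3, w4, w5] = 0 →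
      2 * (p * w1 * w2 + q * w1 * w3 + r * w3 * w5 + x * w2 * w4 + y * w4 * w5 + k * w2 * w5) ≤
        d1 * w1 ^ 2 + d2 * w2 ^ 2 + d3 * w3 ^ 2 + d4 * w4 ^ 2 + d5 * w5 ^ 2 := by
  have hα0 : 0 ≤ α := nonneg_of_mul_nonneg_left (by rw [hα]; exact hE0) (by linarith)
  have hβ0 : 0 ≤ β := nonneg_of_mul_nonneg_left (by rw [hβ]; exact hF0) (by linarith)
  have hd10 : 0 ≤ d1 := by rw [hd1]; positivity
  have hd30 : 0 ≤ d3 := by rw [hd3]; positivity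
  have hκ0 : 0 ≤ κ := nonneg_of_mul_nonneg_left (by rw [hκ]; exact zero_le_one) (by linarith)
  have hκ1 : κ ≤ 1 := by
    linarith [mul_nonneg hκ0 (by linarith : 0 ≤ 2 - (E + F))]
  have hd40 : 0 ≤ d4 := le_trans (mul_nonneg (sub_nonneg.2 hκ1) (by positivity)) hd4
  rcases le_or_gt (q ^ 2 - d1 * d3) 0 with hW | hW
  · refine ⟨![0, 1, 0, 0, 0], ![0, 0, 0, 0, 1], fun w1 w2 w3 w4 w5 h2 h5 => ?_⟩
    simp [dotProduct, Fin.sum_univ_five] at h2 h5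
    subst h2 h5
    have h : 2 * q * (w1 * w3) ≤ d1 * w1 ^ 2 + d3 * w3 ^ 2 := by
      refine le_of_sq_le_sq ?_ (by positivity)
      have := mul_le_mul_of_nonneg_right (sub_nonpos.1 hW) (sq_nonneg (w1 * w3))
      linarith [sq_nonneg (d1 * w1 ^ 2 - d3 * w3 ^ 2)]
    linarith [mul_nonneg hd40 (sq_nonneg w4)]
  · have hq0 : 0 < q := by
      refine hq.lt_of_ne' fun h => ?_
      rw [h] at hW
      linarith [mul_nonneg hd10 hd30]
    set W := q ^ 2 - d1 * d3 with hWdef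
    have hA : 0 < d2 + p ^ 2 * d3 / W := by positivity
    have hB : 0 < d5 + r ^ 2 * d1 / W := by positivity
    obtain ⟨b, a, hba⟩ := exists_functional_of_det_nonpos (A := d2 + p ^ 2 * d3 / W)
      (B := d5 + r ^ 2 * d1 / W) (c := p * r * q / W - k) (x := x) (y := y) (D := d4) hA fun hc => by
        refine det_nonpos_of_le hA hB hx hy (sub_nonneg.2 hκ1) hd4 hc fun hc0 => ?_
        refine le_four_mul_of_sq_le (A' := p + 2 * (p ^ 2 * d3 / W))
          (B' := r + 2 * (r ^ 2 * d1 / W)) hx hy (by positivity) (by positivity)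
          (by linarith) (by linarith) hc0 hκ0 hc.le ?_
        refine four_mul_sq_le hp hr hk hd10 hd30 hκ0 hκ1 hWdef hW rfl hc0 ?_
        have := path_bound hp hq0 hr hE0 hE1 hF0 hF1 hEF hα hβ hκ
          (by rw [← hd1, ← hd3]; linarith)
        rwa [← hd1, ← hd3] at this
    refine ⟨![0, q * p, W, 0, d1 * r], ![0, 0, 0, a, b], fun w1 w2 w3 w4 w5 h1 h2 => ?_⟩
    simp [dotProduct, Fin.sum_univ_five] at h1 h2
    have hN := hba w2 w5 w4 (by linarith)
    have hw3 : w3 = -(q * p * w2 + d1 * r * w5) / W := by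
      rw [eq_div_iff hW.ne']; linarith
    have hsq := mul_nonneg hd10 (sq_nonneg (w1 + (d3 * p * w2 + q * r * w5) / W))
    have hid : d1 * w1 ^ 2 + d2 * w2 ^ 2 + d3 * w3 ^ 2 + d4 * w4 ^ 2 + d5 * w5 ^ 2
        - 2 * (p * w1 * w2 + q * w1 * w3 + r * w3 * w5 + x * w2 * w4 + y * w4 * w5 + k * w2 * w5)
        = d1 * (w1 + (d3 * p * w2 + q * r * w5) / W) ^ 2
        + ((d2 + p ^ 2 * d3 / W) * w2 ^ 2 + 2 * (p * r * q / W - k) * (w2 * w5)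
          + (d5 + r ^ 2 * d1 / W) * w5 ^ 2 - 2 * x * (w2 * w4) - 2 * y * (w5 * w4)
          + d4 * w4 ^ 2) := by
      have hiW : W⁻¹ * (q ^ 2 - d1 * d3) = 1 := by rw [← hWdef]; exact inv_mul_cancel₀ hW.ne'
      rw [hw3]
      simp only [div_eq_mul_inv]
      generalize W⁻¹ = i at hiW
      linear_combination (2 * w1 * p * w2 + i * (d3 * p ^ 2 * w2 ^ 2 - d1 * r ^ 2 * w5 ^ 2)) * hiW
    linarith

open Matrix

lemma exists_pos_mulVec_nonneg {n : ℕ} {P : Matrix (Fin n) (Fin n) ℝ} (hP : P.PosDef)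
    (hoff : ∀ i j, i ≠ j → P i j ≤ 0) :
    ∃ z : Fin n → ℝ, (∀ i, 0 < z i) ∧ ∀ i, 0 ≤ (P *ᵥ z) i := by
  have hu : IsUnit P.det := hP.det_pos.ne'.isUnit
  set z : Fin n → ℝ := P⁻¹ *ᵥ 1 with hz
  have hPz : P *ᵥ z = 1 := by rw [hz, mulVec_mulVec, mul_nonsing_inv _ hu, one_mulVec]
  have hz0 : ∀ i, 0 ≤ z i := by
    by_contra! h
    obtain ⟨i, hi⟩ := h
    set m : Fin n → ℝ := fun i => max (-z i) 0 with hm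
    have hm0 : m ≠ 0 := fun h => by
      have := congrFun h i
      simp [hm] at this
      linarith
    have h1 := hP.dotProduct_mulVec_pos hm0
    have h2 : m ⬝ᵥ P *ᵥ m ≤ -(m ⬝ᵥ P *ᵥ z) := by
      rw [← dotProduct_neg, ← mulVec_neg]
      simp only [dotProduct, mulVec, Finset.mul_sum]
      refine Finset.sum_le_sum fun i _ => Finset.sum_le_sum fun j _ => ?_
      have hmi : 0 ≤ m i := le_max_right _ _
      have hmj : -z j ≤ m j := le_max_left _ _
      by_cases hij : i = j
      · subst hij
        rcases le_total (-z i) 0 with h | h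
        · simp [hm, max_eq_right h]
        · simp [hm, max_eq_left h]
      · have := mul_nonneg hmi (mul_nonneg (neg_nonneg.2 (hoff i j hij)) (sub_nonneg.2 hmj))
        simp only [Pi.neg_apply]
        linarith
    have h3 : 0 ≤ m ⬝ᵥ P *ᵥ z := by
      rw [hPz]
      exact Finset.sum_nonneg fun i _ => mul_nonneg (le_max_right _ _) zero_le_one
    simp only [star_trivial] at h1
    linarith
  refine ⟨z, fun i => (hz0 i).lt_of_ne' fun hi => ?_, fun i => by simp [hPz]⟩
  have h1 : (P *ᵥ z) i = 1 := by rw [hPz]; rfl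
  have h2 : (P *ᵥ z) i ≤ 0 := by
    change ∑ j, P i j * z j ≤ 0
    refine Finset.sum_nonpos fun j _ => ?_
    by_cases hij : i = j
    · subst hij; simp [hi]
    · exact mul_nonpos_of_nonpos_of_nonneg (hoff i j hij) (hz0 j)
  linarith

lemma exists_ne_zero_lt_dotProduct_mulVec {n : ℕ} {A : Matrix (Fin n) (Fin n) ℝ}
    (hA : A.IsHermitian) {ν : ℝ} {s : Finset (Fin n)} (hs : ∀ i ∈ s, ν < hA.eigenvalues i)
    (hcard : 2 < s.card) (f g : (Fin n → ℝ) →ₗ[ℝ] ℝ) :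
    ∃ y : Fin n → ℝ, f y = 0 ∧ g y = 0 ∧ ν * (y ⬝ᵥ y) < y ⬝ᵥ A *ᵥ y := by
  let v : Fin n → Fin n → ℝ := fun i => ⇑(hA.eigenvectorBasis i)
  have hv : ∀ i j, v i ⬝ᵥ v j = if i = j then 1 else 0 := fun i j => by
    have := orthonormal_iff_ite.1 hA.eigenvectorBasis.orthonormal j i
    rw [EuclideanSpace.inner_eq_star_dotProduct] at this
    simp only [star_trivial] at this
    rw [show v i ⬝ᵥ v j = _ from this]
    simp [eq_comm]
  let T : (s → ℝ) →ₗ[ℝ] (Fin n → ℝ) := Fintype.linearCombination ℝ (fun i : s => v i)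
  obtain ⟨c, hc, hc0⟩ := Submodule.exists_mem_ne_zero_of_ne_bot
    (LinearMap.ker_ne_bot_of_finrank_lt (f := ((f.prod g).comp T)) (by simpa using hcard))
  have hT : T c = ∑ i : s, c i • v i := rfl
  have hAT : A *ᵥ T c = ∑ i : s, (hA.eigenvalues i * c i) • v i := by
    rw [hT, mulVec_sum]
    refine Finset.sum_congr rfl fun i _ => ?_
    rw [mulVec_smul, hA.mulVec_eigenvectorBasis, smul_smul, mul_comm]
  have hdot : ∀ b : s → ℝ, T c ⬝ᵥ (∑ i : s, b i • v i) = ∑ i : s, c i * b i := fun b => by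
    simp [hT, sum_dotProduct, dotProduct_sum, hv, mul_comm]
  obtain ⟨hf, hg⟩ : f (T c) = 0 ∧ g (T c) = 0 := Prod.mk_eq_zero.1 hc
  refine ⟨T c, hf, hg, ?_⟩
  rw [hAT, hdot fun i => hA.eigenvalues i * c i]
  conv_lhs => rw [show T c ⬝ᵥ T c = _ from hdot c]
  rw [Finset.mul_sum]
  obtain ⟨i, hi⟩ := Function.ne_iff.1 hc0
  refine Finset.sum_lt_sum (fun j _ => ?_) ⟨i, Finset.mem_univ _, ?_⟩
  · linarith [mul_nonneg (sub_nonneg.2 (hs j j.2).le) (mul_self_nonneg (c j))]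
  · linarith [mul_pos (sub_pos.2 (hs i i.2)) (mul_self_pos.2 hi)]

lemma eigenvalues_le_of_spectralRadius_le {n : ℕ} {A : Matrix (Fin n) (Fin n) ℝ}
    (hA : A.IsHermitian) (h : spectralRadius ℝ A ≤ 1) (i : Fin n) : hA.eigenvalues i ≤ 1 := by
  have h1 := (le_iSup₂ (f := fun k (_ : k ∈ spectrum ℝ A) => (‖k‖₊ : ENNReal)) _
    (hA.eigenvalues_mem_spectrum_real i)).trans h
  have h2 : ‖hA.eigenvalues i‖ ≤ 1 := by exact_mod_cast h1
  exact (le_abs_self _).trans h2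

lemma posDef_smul_one_sub {n : ℕ} {A : Matrix (Fin n) (Fin n) ℝ}
    (hA : A.IsHermitian) {μ : ℝ} (h : ∀ i, hA.eigenvalues i < μ) :
    (μ • (1 : Matrix (Fin n) (Fin n) ℝ) - A).PosDef := by
  have hH : (μ • (1 : Matrix (Fin n) (Fin n) ℝ) - A).IsHermitian :=
    (isHermitian_one.smul (IsSelfAdjoint.all μ)).sub hA
  rw [hH.posDef_iff_eigenvalues_pos]
  intro i
  have h1 := hH.eigenvalues_mem_spectrum_real i
  generalize hH.eigenvalues i = e at h1 ⊢
  rw [← Algebra.algebraMap_eq_smul_one, ← spectrum.singleton_sub_eq] at h1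
  obtain ⟨_, rfl, b, hb, rfl⟩ := h1
  rw [hA.spectrum_real_eq_range_eigenvalues] at hb
  obtain ⟨j, rfl⟩ := hb
  exact sub_pos.2 (h j)

lemma exists_finset_lt_eigenvalues {A : Matrix (Fin 5) (Fin 5) ℝ} (hA : A.IsHermitian)
    {ν l1 l2 l3 l4 l5 : ℝ} (heig : A.charpoly.roots = {l1, l2, l3, l4, l5})
    (h1 : ν < l1) (h2 : ν < l2) (h3 : ν < l3) :
    ∃ s : Finset (Fin 5), (∀ i ∈ s, ν < hA.eigenvalues i) ∧ 2 < s.card := by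
  refine ⟨Finset.univ.filter fun i => ν < hA.eigenvalues i, by simp, ?_⟩
  have h := congrArg (fun m => (m.filter fun a => ν < a).card)
    (hA.roots_charpoly_eq_eigenvalues.symm.trans heig)
  simp only [Multiset.filter_map, Multiset.card_map] at h
  change (Finset.univ.filter fun i => ν < hA.eigenvalues i).card = _ at h
  rw [h]
  simp only [Multiset.insert_eq_cons, Multiset.filter_cons_of_pos _ h1,
    Multiset.filter_cons_of_pos _ h2, Multiset.filter_cons_of_pos _ h3, Multiset.card_cons]
  omega
/-- Pattern H: if `ρ(A) ≤ 1` then `l3 ≤ 1/2`. -/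
theorem stmt_10
    (s t a12 a13 a24 a25 a35 a45 : ℝ)
    (hs : 0 ≤ s) (ht : 0 ≤ t) (h12n : 0 ≤ a12) (h13n : 0 ≤ a13)
    (h24n : 0 ≤ a24) (h25n : 0 ≤ a25) (h35n : 0 ≤ a35) (h45n : 0 ≤ a45)
    (hts : t + s ≤ 1/2)
    (A : Matrix (Fin 5) (Fin 5) ℝ)
    (hA : A = !![1/2 - t - s, a12, a13, 0, 0;
                 a12, 0, 0, a24, a25;
                 a13, 0, t, 0, a35;
                 0, a24, 0, s, a45;
                 0, a25, a35, a45, 0])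
    (l1 l2 l3 l4 l5 : ℝ)
    (hord1 : l1 ≥ l2) (hord2 : l2 ≥ l3) (hord3 : l3 ≥ l4) (hord4 : l4 ≥ l5)
    (heig : A.charpoly.roots = {l1, l2, l3, l4, l5})
    (hρ : spectralRadius ℝ A ≤ 1) :
    l3 ≤ 1/2 := by
  have hH : A.IsHermitian := by
    subst hA
    ext i j
    fin_cases i <;> fin_cases j <;> rfl
  by_contra! h3
  obtain ⟨μ, hμ⟩ : ∃ μ : ℝ, μ = 1 / 2 + l3 := ⟨_, rfl⟩
  have hμ1 : 1 < μ := by linarith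
  have hμ0 : 0 < μ := by linarith
  have hP := posDef_smul_one_sub hH fun i =>
    (eigenvalues_le_of_spectralRadius_le hH hρ i).trans_lt hμ1
  obtain ⟨z, hz, hPz⟩ := exists_pos_mulVec_nonneg hP fun i j hij => by
    subst hA
    fin_cases i <;> fin_cases j <;> simp at hij ⊢ <;> assumption
  obtain ⟨σ, hσ, hσc⟩ := exists_finset_lt_eigenvalues hH (ν := μ / 2) heig
    (by linarith) (by linarith) (by linarith)
  obtain ⟨u, hu⟩ : ∃ u : ℝ, u = 1 / 2 - t - s := ⟨_, rfl⟩
  have hu0 : 0 ≤ u := by linarith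
  rw [← hu] at hA
  have hrow : ∀ i, z i * (A *ᵥ z) i ≤ μ * z i ^ 2 := fun i => by
    have h1 := hPz i
    rw [sub_mulVec, smul_mulVec, one_mulVec, Pi.sub_apply, Pi.smul_apply, smul_eq_mul] at h1
    linarith [mul_nonneg (hz i).le h1]
  have r1 := hrow 0
  have r2 := hrow 1
  have r3 := hrow 2
  have r4 := hrow 3
  have r5 := hrow 4
  simp [hA, mulVec, dotProduct, Fin.sum_univ_five] at r1 r2 r3 r4 r5
  have z1 := hz 0
  have z2 := hz 1
  have z3 := hz 2
  have z4 := hz 3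
  have z5 := hz 4
  obtain ⟨E, hE⟩ : ∃ E : ℝ, μ * E = μ - 2 * u := ⟨(μ - 2 * u) / μ, by field_simp⟩
  obtain ⟨F, hF⟩ : ∃ F : ℝ, μ * F = μ - 2 * t := ⟨(μ - 2 * t) / μ, by field_simp⟩
  obtain ⟨G, hG⟩ : ∃ G : ℝ, μ * G = μ - 2 * s := ⟨(μ - 2 * s) / μ, by field_simp⟩
  have hE0 : 0 ≤ E := by
    refine le_of_mul_le_mul_left ?_ hμ0
    linarith
  have hE1 : E ≤ 1 := by
    refine le_of_mul_le_mul_left ?_ hμ0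
    linarith
  have hF0 : 0 ≤ F := by
    refine le_of_mul_le_mul_left ?_ hμ0
    linarith
  have hF1 : F ≤ 1 := by
    refine le_of_mul_le_mul_left ?_ hμ0
    linarith
  have hEF : 1 ≤ E + F := by
    refine le_of_mul_le_mul_left ?_ hμ0
    linarith
  have hEFG : 2 ≤ E + F + G := by
    refine le_of_mul_le_mul_left ?_ hμ0
    linarith
  have hS : 0 < 3 - (E + F) := by linarith
  have hG0 : 0 ≤ G := by linarith
  have hα : E / (1 + E) * (1 + E) = E := div_mul_cancel₀ _ (by positivity)
  have hβ : F / (1 + F) * (1 + F) = F := div_mul_cancel₀ _ (by positivity)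
  have hα0 : 0 ≤ E / (1 + E) := by positivity
  have hβ0 : 0 ≤ F / (1 + F) := by positivity
  have hδ : (1 - 1 / (3 - (E + F))) * (1 + G) ≤ G := by
    have : (1 - 1 / (3 - (E + F))) * (1 + G) = G - (E + F + G - 2) / (3 - (E + F)) := by
      field_simp; ring
    rw [this]
    exact sub_le_self _ (div_nonneg (by linarith) hS.le)
  have hδ0 : 0 ≤ 1 - 1 / (3 - (E + F)) := by
    rw [sub_nonneg, div_le_one hS]
    linarith
  obtain ⟨f, g, hfg⟩ := exists_functionals_house_form_nonpos
    (p := a12 * z 0 * z 1) (q := a13 * z 0 * z 2) (r := a35 * z 2 * z 4) (x := a24 * z 1 * z 3)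
    (y := a45 * z 3 * z 4) (k := a25 * z 1 * z 4) (d2 := μ / 2 * z 1 ^ 2)
    (d4 := μ / 2 * G * z 3 ^ 2)
    (d5 := μ / 2 * z 4 ^ 2)
    (by positivity) (by positivity) (by positivity) (by positivity) (by positivity) (by positivity)
    hE0 hE1 hF0 hF1 hEF hα hβ (div_mul_cancel₀ 1 hS.ne') rfl rfl
    (by linarith) (by positivity) (by linarith) (by positivity)
    (by
      have h1 : a24 * z 1 * z 3 + a45 * z 3 * z 4 ≤ μ / 2 * (1 + G) * z 3 ^ 2 := by
        rw [show μ / 2 * (1 + G) = μ - s by linarith]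
        linarith
      calc _ ≤ (1 - 1 / (3 - (E + F))) * (μ / 2 * (1 + G) * z 3 ^ 2) := by gcongr
        _ = (1 - 1 / (3 - (E + F))) * (1 + G) * (μ / 2 * z 3 ^ 2) := by ring
        _ ≤ G * (μ / 2 * z 3 ^ 2) := by gcongr
        _ = _ := by ring)
  obtain ⟨y, hfy, hgy, hy⟩ := exists_ne_zero_lt_dotProduct_mulVec hH hσ hσc
    (dotProductEquiv ℝ (Fin 5) fun i => f i / z i) (dotProductEquiv ℝ (Fin 5) fun i => g i / z i)
  obtain ⟨w, rfl⟩ : ∃ w : Fin 5 → ℝ, y = fun i => z i * w i :=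
    ⟨fun i => y i / z i, funext fun i => (mul_div_cancel₀ _ (hz i).ne').symm⟩
  have hcancel : ∀ a : Fin 5 → ℝ, (fun i => a i / z i) ⬝ᵥ (fun i => z i * w i) =
      a ⬝ᵥ ![w 0, w 1, w 2, w 3, w 4] := fun a => by
    simp only [dotProduct, ← mul_assoc, div_mul_cancel₀ _ (hz _).ne', Fin.sum_univ_five]
    rfl
  rw [dotProductEquiv_apply_apply, hcancel] at hfy hgy
  have hK := hfg _ _ _ _ _ hfy hgy
  have hd1 : E / (1 + E) * (a12 * z 0 * z 1 + a13 * z 0 * z 2) ≤ (μ / 2 - u) * z 0 ^ 2 := calc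
    _ ≤ E / (1 + E) * ((μ - u) * z 0 ^ 2) := by
        gcongr
        linarith
    _ = E / (1 + E) * (1 + E) * (μ / 2) * z 0 ^ 2 := by
        rw [show μ - u = (1 + E) * (μ / 2) by linarith]
        ring
    _ = _ := by rw [hα, show E * (μ / 2) = μ / 2 - u by linarith]
  have hd3 : F / (1 + F) * (a13 * z 0 * z 2 + a35 * z 2 * z 4) ≤ (μ / 2 - t) * z 2 ^ 2 := calc
    _ ≤ F / (1 + F) * ((μ - t) * z 2 ^ 2) := by
        gcongr
        linarith
    _ = F / (1 + F) * (1 + F) * (μ / 2) * z 2 ^ 2 := by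
        rw [show μ - t = (1 + F) * (μ / 2) by linarith]
        ring
    _ = _ := by rw [hβ, show F * (μ / 2) = μ / 2 - t by linarith]
  rw [show μ / 2 * G = μ / 2 - s by linarith] at hK
  simp [hA, mulVec, dotProduct, Fin.sum_univ_five] at hy
  linarith [mul_le_mul_of_nonneg_right hd1 (sq_nonneg (w 0)),
    mul_le_mul_of_nonneg_right hd3 (sq_nonneg (w 2))]
end

section
/- If every 4×4 principal submatrix of A (obtained by deleting one row and the corresponding column) has spectral radius at most 1, then λ3 ≤ 1/2. -/
open Matrix

theorem Matrix.dotProduct_mulVec_le_of_spectralRadius_le_one {n : Type*} [Fintype n] [DecidableEq n]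
    {B : Matrix n n ℝ} (hB : B.IsHermitian) (h : spectralRadius ℝ B ≤ 1) (x : n → ℝ) :
    x ⬝ᵥ B *ᵥ x ≤ x ⬝ᵥ x := by
  have hs : ∀ μ ∈ spectrum ℝ B, μ ≤ 1 := fun μ hμ => by
    have h1 : (‖μ‖₊ : ENNReal) ≤ 1 :=
      (le_iSup₂ (f := fun (k : ℝ) (_ : k ∈ spectrum ℝ B) => (‖k‖₊ : ENNReal)) μ hμ).trans h
    have h2 : ‖μ‖₊ ≤ 1 := by exact_mod_cast h1
    have h3 : |μ| ≤ 1 := by simpa using NNReal.coe_le_coe.2 h2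
    exact (abs_le.1 h3).2
  have hC : (1 - B).IsHermitian := isHermitian_one.sub hB
  have hP : (1 - B).PosSemidef := by
    rw [hC.posSemidef_iff_eigenvalues_nonneg]
    intro i
    have hm := hC.eigenvalues_mem_spectrum_real i
    have hm' : 1 - hC.eigenvalues i ∈ spectrum ℝ B := by
      have := spectrum.sub_singleton_eq (R := ℝ) (1 - B) (1 : ℝ)
      have h4 : hC.eigenvalues i - 1 ∈ spectrum ℝ (-B) := by
        have h5 : (1 - B) - algebraMap ℝ _ 1 = -B := by simp
        rw [← h5, ← this]
        exact ⟨_, hm, 1, rfl, rfl⟩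
      rw [← spectrum.neg_eq] at h4
      simpa using h4
    have := hs _ hm'
    simp only [Pi.zero_apply]
    linarith
  have := hP.dotProduct_mulVec_nonneg x
  simp only [star_trivial, sub_mulVec, one_mulVec, dotProduct_sub] at this
  linarith

theorem Matrix.exists_lt_dotProduct_mulVec_of_card {n : Type*} [Fintype n] [DecidableEq n]
    {A : Matrix n n ℝ} (hA : A.IsHermitian) {c : ℝ}
    (hc : 2 < (Finset.univ.filter fun i => c < hA.eigenvalues i).card) (p q : n → ℝ) :
    ∃ x : n → ℝ, p ⬝ᵥ x = 0 ∧ q ⬝ᵥ x = 0 ∧ c * (x ⬝ᵥ x) < x ⬝ᵥ A *ᵥ x := by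
  set U : Matrix n n ℝ := hA.eigenvectorUnitary.1 with hU
  have hUU : Uᵀ * U = 1 := by
    simpa [hU, star_eq_conjTranspose] using Unitary.coe_star_mul_self hA.eigenvectorUnitary
  have hAU : A * U = U * diagonal hA.eigenvalues := by
    have h := hA.spectral_theorem
    rw [Unitary.conjStarAlgAut_apply] at h
    have h2 : A = U * diagonal hA.eigenvalues * Uᵀ := by
      simpa [hU, star_eq_conjTranspose, Function.comp_def] using h
    conv_lhs => rw [h2]
    rw [Matrix.mul_assoc, hUU, Matrix.mul_one]
  set S := {i // c < hA.eigenvalues i}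
  let e : (S → ℝ) →ₗ[ℝ] (n → ℝ) :=
    U.mulVecLin ∘ₗ 
      { toFun := fun d i => if h : c < hA.eigenvalues i then d ⟨i, h⟩ else 0
        map_add' := fun d d' => by ext i; by_cases h : c < hA.eigenvalues i <;> simp [h]
        map_smul' := fun r d => by ext i; by_cases h : c < hA.eigenvalues i <;> simp [h] }
  let f : (S → ℝ) →ₗ[ℝ] (Fin 2 → ℝ) := LinearMap.pi ![dotProductBilin ℝ ℝ p ∘ₗ e, dotProductBilin ℝ ℝ q ∘ₗ e]
  have hk : LinearMap.ker f ≠ ⊥ := by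
    apply LinearMap.ker_ne_bot_of_finrank_lt
    simpa [S, Fintype.card_subtype] using hc
  obtain ⟨d, hd, hd0⟩ := (Submodule.ne_bot_iff _).1 hk
  have hd1 := congrFun (LinearMap.mem_ker.1 hd) 0
  have hd2 := congrFun (LinearMap.mem_ker.1 hd) 1
  set w : n → ℝ := fun i => if h : c < hA.eigenvalues i then d ⟨i, h⟩ else 0 with hw
  have hew : e d = U *ᵥ w := rfl
  refine ⟨e d, by simpa [f] using hd1, by simpa [f] using hd2, ?_⟩
  have key : ∀ v : n → ℝ, (U *ᵥ w) ⬝ᵥ (U *ᵥ v) = w ⬝ᵥ v := fun v => by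
    rw [dotProduct_mulVec, ← mulVec_transpose, mulVec_mulVec, hUU, one_mulVec]
  rw [hew, mulVec_mulVec, hAU, ← mulVec_mulVec, key, key]
  simp only [dotProduct, mulVec_diagonal, Finset.mul_sum]
  obtain ⟨i, hi⟩ := Function.ne_iff.1 hd0
  have hle : ∀ j, c * (w j * w j) ≤ w j * (hA.eigenvalues j * w j) := fun j => by
    by_cases h : c < hA.eigenvalues j
    · nlinarith [mul_self_nonneg (w j)]
    · simp [hw, h]
  refine Finset.sum_lt_sum (fun j _ => hle j) ⟨i, Finset.mem_univ _, ?_⟩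
  have hwi : w i ≠ 0 := by simpa [hw, i.2] using hi
  have := i.2
  have : 0 < w i * w i := mul_self_pos.2 hwi
  nlinarith

theorem Matrix.two_lt_card_of_roots_charpoly {A : Matrix (Fin 5) (Fin 5) ℝ} (hA : A.IsHermitian)
    {l1 l2 l3 l4 l5 c : ℝ} (h1 : l1 ≥ l2) (h2 : l2 ≥ l3) (h3 : c < l3)
    (h : A.charpoly.roots = {l1, l2, l3, l4, l5}) :
    2 < (Finset.univ.filter fun i => c < hA.eigenvalues i).card := by
  have h4 : ((Finset.univ.val.map hA.eigenvalues).filter (fun y => c < y)).card =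
      (Finset.univ.filter fun i => c < hA.eigenvalues i).card := by
    rw [Multiset.filter_map, Multiset.card_map]; rfl
  rw [← h4]
  have h5 : Finset.univ.val.map hA.eigenvalues = {l1, l2, l3, l4, l5} := by
    rw [← h, hA.roots_charpoly_eq_eigenvalues]; rfl
  rw [h5]
  have : ({l1, l2, l3} : Multiset ℝ) ≤ Multiset.filter (fun y => c < y) {l1, l2, l3, l4, l5} := by
    rw [Multiset.le_filter]
    refine ⟨?_, ?_⟩
    · have : ({l1, l2, l3, l4, l5} : Multiset ℝ) = {l1, l2, l3} + {l4, l5} := rfl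
      rw [this]; exact Multiset.le_add_right _ _
    · intro y hy
      simp at hy
      rcases hy with rfl | rfl | rfl <;> linarith
  exact Nat.lt_of_succ_le (Multiset.card_le_card this)

theorem quarticForm_path_le {ni nj nk nl p q r : ℝ} (hi : 0 < ni) (hl : 0 < nl)
    (hp : 0 ≤ p) (hq : 0 ≤ q) (hr : 0 ≤ r)
    (h : ∀ xi xj xk xl : ℝ, 0 ≤ xi → 0 ≤ xj → 0 ≤ xk → 0 ≤ xl →
      2 * (p * xi * xj + q * xj * xk + r * xk * xl) ≤
        ni * xi ^ 2 + nj * xj ^ 2 + nk * xk ^ 2 + nl * xl ^ 2) :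
    p ^ 2 ≤ ni * nj ∧ r ^ 2 ≤ nk * nl ∧
      q ^ 2 * ni * nl ≤ (ni * nj - p ^ 2) * (nk * nl - r ^ 2) := by
  have key : ∀ α β : ℝ, 0 ≤ α → 0 ≤ β → 2 * q * α * β * (ni * nl) ≤
      α ^ 2 * (ni * nj - p ^ 2) * nl + β ^ 2 * (nk * nl - r ^ 2) * ni := fun α β hα hβ => by
    have h1 := h (p * α / ni) α β (r * β / nl) (by positivity) hα hβ (by positivity)
    have h2 := mul_le_mul_of_nonneg_right h1 (mul_pos hi hl).le
    field_simp at h2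
    linear_combination h2
  have hU : 0 ≤ ni * nj - p ^ 2 := by
    have := key 1 0 zero_le_one le_rfl
    exact nonneg_of_mul_nonneg_left (by linarith) hl
  have hV : 0 ≤ nk * nl - r ^ 2 := by
    have := key 0 1 le_rfl zero_le_one
    exact nonneg_of_mul_nonneg_left (by linarith) hi
  refine ⟨by linarith, by linarith, ?_⟩
  generalize ni * nj - p ^ 2 = u at *
  generalize nk * nl - r ^ 2 = v at *
  rcases hU.eq_or_lt with rfl | hu
  · rcases hV.eq_or_lt with rfl | hv
    · have h1 := key 1 1 zero_le_one zero_le_one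
      have : q ≤ 0 := by
        by_contra! hq
        have : 0 < q * (ni * nl) := by positivity
        linarith
      have : q = 0 := le_antisymm this hq
      simp [this]
    · have h1 := key v (q * nl) hv.le (by positivity)
      have h2 : q ^ 2 * (v * nl ^ 2 * ni) ≤ 0 := by linarith
      have h3 : q ^ 2 ≤ 0 := by
        by_contra! h4
        have : 0 < q ^ 2 * (v * nl ^ 2 * ni) := by positivity
        linarith
      nlinarith [mul_pos hi hl]
  · have h1 := key (q * ni) u (by positivity) hu.le
    have h2 : q ^ 2 * ni * nl * (u * ni) ≤ u * v * (u * ni) := by linear_combination h1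
    exact le_of_mul_le_mul_right h2 (by positivity)

theorem lt_quarticForm_path {mi mj mk ml p q r d : ℝ} (hi : 0 < mi) (hl : 0 < ml)
    (hk : 0 ≤ mk) (hq : 0 ≤ q) (hr : 0 ≤ r) (hd : 0 ≤ d)
    (h : ∀ α β : ℝ, ∃ xi xj xk xl : ℝ, β * xj = α * xk ∧
      mi * xi ^ 2 + mj * xj ^ 2 + mk * xk ^ 2 + ml * xl ^ 2 <
        2 * (p * xi * xj + q * xj * xk + r * xk * xl + d * xj * xl)) :
    mi * mj < p ^ 2 ∧ mk * ml < r ^ 2 ∧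
      q ^ 2 * mi * ml ≤ (p ^ 2 - mi * mj) * (r ^ 2 - mk * ml) := by
  have key : ∀ α β : ℝ, ∃ x y : ℝ, β * x = α * y ∧
      0 < x ^ 2 * ((p ^ 2 - mi * mj) * ml + d ^ 2 * mi) +
        2 * x * y * (q * ml + d * r) * mi + y ^ 2 * ((r ^ 2 - mk * ml) * mi) := fun α β => by
    obtain ⟨xi, x, y, xl, h1, h2⟩ := h α β
    refine ⟨x, y, h1, ?_⟩
    have h3 := mul_lt_mul_of_pos_right h2 (mul_pos hi hl)
    nlinarith [mul_nonneg hl.le (sq_nonneg (mi * xi - p * x)),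
      mul_nonneg hi.le (sq_nonneg (ml * xl - r * y - d * x))]
  have hv : 0 < r ^ 2 - mk * ml := by
    obtain ⟨x, y, h1, h2⟩ := key 0 1
    have hx : x = 0 := by linarith
    subst hx
    by_contra! hc
    nlinarith [mul_nonneg (sq_nonneg y) (mul_nonneg hi.le (neg_nonneg.2 hc))]
  generalize hu' : p ^ 2 - mi * mj = u at *
  generalize hv' : r ^ 2 - mk * ml = v at *
  have hdet : (q * ml + d * r) ^ 2 * mi < (u * ml + d ^ 2 * mi) * v := by
    obtain ⟨x, y, h1, h2⟩ := key (v * mi) (-((q * ml + d * r) * mi))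
    have hvm : 0 < v * mi := by positivity
    have h3 : 0 < v * mi * (x ^ 2 * (u * ml + d ^ 2 * mi) +
        2 * x * y * (q * ml + d * r) * mi + y ^ 2 * (v * mi)) := mul_pos hvm h2
    have h4 : v * mi * (x ^ 2 * (u * ml + d ^ 2 * mi) +
        2 * x * y * (q * ml + d * r) * mi + y ^ 2 * (v * mi)) =
        x ^ 2 * mi * ((u * ml + d ^ 2 * mi) * v - (q * ml + d * r) ^ 2 * mi) := by
      linear_combination (-(v * mi * y) - x * (q * ml + d * r) * mi) * h1
    rw [h4] at h3
    by_contra! hc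
    nlinarith [mul_nonneg (mul_nonneg (sq_nonneg x) hi.le) (sub_nonneg.2 hc)]
  have hvr : v ≤ r ^ 2 := by nlinarith
  have huv : q ^ 2 * mi * ml < u * v := by
    have h1 : d ^ 2 * mi * v ≤ d ^ 2 * mi * r ^ 2 := by gcongr
    have h2 : 0 ≤ q * d * r * ml * mi := by positivity
    have h3 : q ^ 2 * mi * ml * ml < u * v * ml := by nlinarith
    exact lt_of_mul_lt_mul_right h3 hl.le
  refine ⟨?_, by linarith, huv.le⟩
  have : 0 < u * v := lt_of_le_of_lt (by positivity) huv
  linarith [(pos_iff_pos_of_mul_pos this).2 hv]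

theorem lt_quadForm_fourCycle {mi mj mk ml a b c d : ℝ} (hi : 0 < mi) (hl : 0 < ml)
    (hc : mj * mi * ml < a ^ 2 * ml + c ^ 2 * mi)
    (h : ∀ α β : ℝ, ∃ xi xj xk xl : ℝ, β * xj = α * xk ∧
      mi * xi ^ 2 + mj * xj ^ 2 + mk * xk ^ 2 + ml * xl ^ 2 <
        2 * (a * xi * xj + b * xi * xk + c * xl * xj + d * xl * xk)) :
    (a * b * ml + c * d * mi) ^ 2 <
      (a ^ 2 * ml + c ^ 2 * mi - mj * mi * ml) * (b ^ 2 * ml + d ^ 2 * mi - mk * mi * ml) := by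
  obtain ⟨xi, x, y, xl, h1, h2⟩ :=
    h (-(a * b * ml + c * d * mi)) (a ^ 2 * ml + c ^ 2 * mi - mj * mi * ml)
  have h3 := mul_lt_mul_of_pos_right h2 (mul_pos hi hl)
  have h4 : 0 < x ^ 2 * (a ^ 2 * ml + c ^ 2 * mi - mj * mi * ml) +
      2 * x * y * (a * b * ml + c * d * mi) +
      y ^ 2 * (b ^ 2 * ml + d ^ 2 * mi - mk * mi * ml) := by
    nlinarith [mul_nonneg hl.le (sq_nonneg (mi * xi - a * x - b * y)),
      mul_nonneg hi.le (sq_nonneg (ml * xl - c * x - d * y))]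
  have hu : 0 < a ^ 2 * ml + c ^ 2 * mi - mj * mi * ml := by linarith
  generalize a ^ 2 * ml + c ^ 2 * mi - mj * mi * ml = u at *
  generalize b ^ 2 * ml + d ^ 2 * mi - mk * mi * ml = v at *
  generalize a * b * ml + c * d * mi = e at *
  have h5 := mul_pos hu h4
  have h6 : u * (x ^ 2 * u + 2 * x * y * e + y ^ 2 * v) = y ^ 2 * (u * v - e ^ 2) := by
    linear_combination (u * x + e * y) * h1
  rw [h6] at h5
  by_contra! hcon
  nlinarith [mul_nonneg (sq_nonneg y) (sub_nonneg.2 hcon)]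

theorem mul_lt_sq_of_quadForm {mj mk f x y : ℝ} (hj : 0 < mj)
    (h : mj * x ^ 2 + mk * y ^ 2 < 2 * f * x * y) : mj * mk < f ^ 2 := by
  have h1 := mul_lt_mul_of_pos_right h hj
  by_contra! hc
  nlinarith [sq_nonneg (mj * x - f * y), mul_nonneg (sq_nonneg y) (sub_nonneg.2 hc)]

theorem estimate_of_intermediate {κ ρ θ ξ ro : ℝ} (hρ : 0 < ρ) (hθ : 0 < θ) (hθ' : θ ≤ 1 / 2)
    (hro : 0 ≤ ro) (hκρ : ρ < κ) (h2 : κ ≤ 1 - ξ) (h3 : θ * (κ + ρ) ≤ ξ)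
    (h4 : ξ * ro * ρ ≤ (κ ^ 2 - ρ ^ 2) * (1 - ξ)) :
    0 < 1 - ρ - 2 * θ * ρ ∧
      ro * ρ * θ * (1 + θ) ^ 2 ≤ (1 - ρ - 2 * θ * ρ) * (1 - θ * ρ) := by
  have hκ : 0 < κ := hρ.trans hκρ
  have h5 : ro * ρ * θ ≤ (κ - ρ) * (1 - θ * (κ + ρ)) := by
    have h6 : ro * ρ * (θ * (κ + ρ)) ≤ ro * ρ * ξ := by gcongr
    have h7 : (κ ^ 2 - ρ ^ 2) * (1 - ξ) ≤ (κ ^ 2 - ρ ^ 2) * (1 - θ * (κ + ρ)) := by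
      exact mul_le_mul_of_nonneg_left (by linarith) (by nlinarith)
    have h8 : ro * ρ * θ * (κ + ρ) ≤ (κ - ρ) * (1 - θ * (κ + ρ)) * (κ + ρ) := by linarith
    exact le_of_mul_le_mul_right h8 (by positivity)
  have h6 : κ * (1 + θ) ≤ 1 - θ * ρ := by linarith
  refine ⟨by nlinarith [mul_pos (sub_pos.2 hκρ) (by linarith : (0 : ℝ) < 1 + θ)], ?_⟩
  have h7 : (κ - ρ) * (1 - θ * (κ + ρ)) * (1 + θ) ^ 2 ≤ (1 - ρ - 2 * θ * ρ) * (1 - θ * ρ) := by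
    have h8 : (1 - ρ - 2 * θ * ρ) * (1 - θ * ρ) - (κ - ρ) * (1 - θ * (κ + ρ)) * (1 + θ) ^ 2 =
        (1 - θ * ρ - κ * (1 + θ)) * (1 + θ - θ * (1 - θ * ρ) - θ * (κ * (1 + θ))) := by ring
    have h9 : 0 ≤ 1 + θ - θ * (1 - θ * ρ) - θ * (κ * (1 + θ)) := by
      have : θ * (κ * (1 + θ)) ≤ θ * (1 - θ * ρ) := by gcongr
      have : 0 ≤ θ * (θ * ρ) := by positivity
      nlinarith
    have := mul_nonneg (sub_nonneg.2 h6) h9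
    linarith
  have h8 : ro * ρ * θ * (1 + θ) ^ 2 ≤ (κ - ρ) * (1 - θ * (κ + ρ)) * (1 + θ) ^ 2 := by gcongr
  exact h8.trans h7

theorem sqrt_estimate_of_normalized {a b c ri rj rk rl ro : ℝ} (hri : 0 < ri) (hrj : 0 < rj)
    (hrk : 0 < rk) (hrl : 0 < rl) (hro : 0 ≤ ro) (hri' : ri ≤ 1 / 2) (hrl' : rl ≤ 1 / 2)
    (ha : ri * rj ≤ a) (hb : rk * rl ≤ b) (ha1 : a ≤ 1) (hb1 : b ≤ 1) (hc : rj * rk < c)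
    (hn : c ≤ (1 - a) * (1 - b)) (he : ri * rl * c ≤ (a - ri * rj) * (b - rk * rl))
    (hea : a * ro * rk ≤ (c - rj * rk) * (1 - a)) (heb : b * ro * rj ≤ (c - rj * rk) * (1 - b)) :
    0 < 1 - √(rj * rk) - 2 * √(ri * rl) * √(rj * rk) ∧
      ro * √(rj * rk) * √(ri * rl) * (1 + √(ri * rl)) ^ 2 ≤
        (1 - √(rj * rk) - 2 * √(ri * rl) * √(rj * rk)) * (1 - √(ri * rl) * √(rj * rk)) := by
  have hρ2 : √(rj * rk) ^ 2 = rj * rk := Real.sq_sqrt (by positivity)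
  have hθ2 : √(ri * rl) ^ 2 = ri * rl := Real.sq_sqrt (by positivity)
  have hρ : 0 < √(rj * rk) := Real.sqrt_pos.2 (by positivity)
  have hθ : 0 < √(ri * rl) := Real.sqrt_pos.2 (by positivity)
  have hc0 : 0 < c := lt_of_le_of_lt (by positivity) hc
  have hκ2 : √c ^ 2 = c := Real.sq_sqrt hc0.le
  have hκ : 0 < √c := Real.sqrt_pos.2 hc0
  have hκρ : √(rj * rk) < √c := Real.sqrt_lt_sqrt (by positivity) hc
  have ha0 : 0 < a := lt_of_lt_of_le (by positivity) ha
  have hb0 : 0 < b := lt_of_lt_of_le (by positivity) hb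
  have hξ2 : √(a * b) ^ 2 = a * b := Real.sq_sqrt (by positivity)
  have hξ : 0 < √(a * b) := Real.sqrt_pos.2 (by positivity)
  generalize √(rj * rk) = ρ at *
  generalize √(ri * rl) = θ at *
  generalize √c = κ at *
  generalize √(a * b) = ξ at *
  have hθ' : θ ≤ 1 / 2 := by
    have h : ri * rl ≤ 1 / 2 * (1 / 2) := by gcongr
    exact (sq_le_sq₀ hθ.le (by norm_num)).1 (by linarith)
  have hξ1 : ξ ≤ 1 := by
    have h : a * b ≤ 1 := mul_le_one₀ ha1 hb0.le hb1
    exact (sq_le_sq₀ hξ.le zero_le_one).1 (by linarith)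
  have habξ : 2 * ξ ≤ a + b := by
    refine (sq_le_sq₀ (by positivity) (by positivity)).1 ?_
    linarith [sq_nonneg (a - b)]
  have h1 : (1 - a) * (1 - b) ≤ (1 - ξ) ^ 2 := by linarith
  have h2 : κ ≤ 1 - ξ := by
    refine (sq_le_sq₀ (by positivity) (by linarith)).1 ?_
    linarith
  have h3 : θ * (κ + ρ) ≤ ξ := by
    have h4 : 2 * ((θ * κ) * (θ * ρ)) ≤ (a - ri * rj) * (rk * rl) + (b - rk * rl) * (ri * rj) := by
      have hA : 0 ≤ a - ri * rj := by linarith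
      have hB : 0 ≤ b - rk * rl := by linarith
      refine (sq_le_sq₀ (by positivity) (by positivity)).1 ?_
      have h5 : (ri * rl * c) * (ri * rl * (rj * rk)) ≤
          ((a - ri * rj) * (b - rk * rl)) * (ri * rl * (rj * rk)) := by gcongr
      have h6 : (2 * ((θ * κ) * (θ * ρ))) ^ 2 = 4 * ((ri * rl * c) * (ri * rl * (rj * rk))) := by
        rw [← hρ2, ← hθ2, ← hκ2]; ring
      rw [h6]
      linarith [sq_nonneg ((a - ri * rj) * (rk * rl) - (b - rk * rl) * (ri * rj))]
    refine (sq_le_sq₀ (by positivity) hξ.le).1 ?_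
    have h7 : (θ * κ) ^ 2 = ri * rl * c := by rw [← hθ2, ← hκ2]; ring
    have h8 : (θ * ρ) ^ 2 = ri * rj * (rk * rl) := by
      rw [mul_pow, hρ2, hθ2]; ring
    linarith
  have h4 : ξ * ro * ρ ≤ (κ ^ 2 - ρ ^ 2) * (1 - ξ) := by
    have hcR : 0 < κ ^ 2 - ρ ^ 2 := by linarith
    refine (sq_le_sq₀ (by positivity) (mul_nonneg hcR.le (by linarith))).1 ?_
    have h5 := mul_le_mul hea heb (by positivity) (mul_nonneg (by linarith) (by linarith))
    calc (ξ * ro * ρ) ^ 2 = a * ro * rk * (b * ro * rj) := by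
          rw [mul_pow, mul_pow, hξ2, hρ2]; ring
      _ ≤ _ := h5
      _ = (κ ^ 2 - ρ ^ 2) ^ 2 * ((1 - a) * (1 - b)) := by rw [hκ2, hρ2]; ring
      _ ≤ (κ ^ 2 - ρ ^ 2) ^ 2 * (1 - ξ) ^ 2 := by gcongr
      _ = _ := by ring
  exact estimate_of_intermediate hρ hθ hθ' hro hκρ h2 h3 h4

theorem sqrt_estimate_of_path {mi mj mk ml mo E1 F E2 G1 G2 : ℝ} (hmi : 0 < mi) (hmj : 0 < mj)
    (hmk : 0 < mk) (hml : 0 < ml) (hmo : 0 ≤ mo) (hmi' : mi ≤ 1 / 2) (hml' : ml ≤ 1 / 2)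
    (hE1 : mi * mj < E1) (hF : mj * mk < F) (hE2 : mk * ml < E2)
    (he : F * mi * ml ≤ (E1 - mi * mj) * (E2 - mk * ml))
    (hea : 0 < mo → E1 * mo * mk ≤ (G1 - mo * mi) * (F - mj * mk))
    (heb : 0 < mo → E2 * mo * mj ≤ (G2 - mo * ml) * (F - mj * mk))
    (hn1 : E1 ≤ (mi + 1 / 2) * (mj + 1 / 2)) (hn2 : E2 ≤ (mk + 1 / 2) * (ml + 1 / 2))
    (hG1 : G1 ≤ (mo + 1 / 2) * (mi + 1 / 2)) (hG2 : G2 ≤ (mo + 1 / 2) * (ml + 1 / 2))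
    (hn : F * (mi + 1 / 2) * (ml + 1 / 2) ≤
      ((mi + 1 / 2) * (mj + 1 / 2) - E1) * ((mk + 1 / 2) * (ml + 1 / 2) - E2))
    (hna : E1 * (mo + 1 / 2) * (mk + 1 / 2) ≤
      ((mo + 1 / 2) * (mi + 1 / 2) - G1) * ((mj + 1 / 2) * (mk + 1 / 2) - F))
    (hnb : E2 * (mo + 1 / 2) * (mj + 1 / 2) ≤
      ((mo + 1 / 2) * (ml + 1 / 2) - G2) * ((mj + 1 / 2) * (mk + 1 / 2) - F)) :
    let ρ := √(mj / (mj + 1 / 2) * (mk / (mk + 1 / 2)))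
    let θ := √(mi / (mi + 1 / 2) * (ml / (ml + 1 / 2)))
    0 < 1 - ρ - 2 * θ * ρ ∧
      mo / (mo + 1 / 2) * ρ * θ * (1 + θ) ^ 2 ≤ (1 - ρ - 2 * θ * ρ) * (1 - θ * ρ) := by
  intro ρ θ
  have half : ∀ m : ℝ, 0 < m → m ≤ 1 / 2 → m / (m + 1 / 2) ≤ 1 / 2 := fun m h0 h => by
    rw [div_le_iff₀ (by linarith)]; linarith
  have hri' := half mi hmi hmi'
  have hrl' := half ml hml hml'
  have repr : ∀ m : ℝ, 0 ≤ m → ∃ r n : ℝ, r = m / (m + 1 / 2) ∧ n = m + 1 / 2 ∧ m = r * n ∧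
      0 < n := fun m hm => ⟨_, _, rfl, rfl, by field_simp, by linarith⟩
  obtain ⟨ri, ni, hri, hni, hi, hni0⟩ := repr mi hmi.le
  obtain ⟨rj, nj, hrj, hnj, hj, hnj0⟩ := repr mj hmj.le
  obtain ⟨rk, nk, hrk, hnk, hk, hnk0⟩ := repr mk hmk.le
  obtain ⟨rl, nl, hrl, hnl, hl, hnl0⟩ := repr ml hml.le
  obtain ⟨ro, no, hro, hno, ho, hno0⟩ := repr mo hmo
  have hri0 : 0 < ri := by rw [hri]; positivity
  have hrj0 : 0 < rj := by rw [hrj]; positivity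
  have hrk0 : 0 < rk := by rw [hrk]; positivity
  have hrl0 : 0 < rl := by rw [hrl]; positivity
  have hro0 : 0 ≤ ro := by rw [hro]; positivity
  simp only [ρ, θ]
  rw [← hri, ← hrj, ← hrk, ← hrl, ← hro]
  rw [← hri] at hri'
  rw [← hrl] at hrl'
  simp only [← hni, ← hnj, ← hnk, ← hnl, ← hno] at *
  clear_value ρ θ
  clear hri hrj hrk hrl hro hni hnj hnk hnl hno half repr
  subst hi hj hk hl ho
  obtain ⟨a, rfl⟩ : ∃ a, E1 = a * (ni * nj) := ⟨E1 / (ni * nj), by field_simp⟩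
  obtain ⟨b, rfl⟩ : ∃ b, E2 = b * (nk * nl) := ⟨E2 / (nk * nl), by field_simp⟩
  obtain ⟨c, rfl⟩ : ∃ c, F = c * (nj * nk) := ⟨F / (nj * nk), by field_simp⟩
  obtain ⟨g1, rfl⟩ : ∃ g, G1 = g * (no * ni) := ⟨G1 / (no * ni), by field_simp⟩
  obtain ⟨g2, rfl⟩ : ∃ g, G2 = g * (no * nl) := ⟨G2 / (no * nl), by field_simp⟩
  have ha : ri * rj < a := lt_of_mul_lt_mul_right (by linarith) (mul_pos hni0 hnj0).le
  have hb : rk * rl < b := lt_of_mul_lt_mul_right (by linarith) (mul_pos hnk0 hnl0).le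
  have hc : rj * rk < c := lt_of_mul_lt_mul_right (by linarith) (mul_pos hnj0 hnk0).le
  have ha1 : a ≤ 1 := le_of_mul_le_mul_right (by linarith) (mul_pos hni0 hnj0)
  have hb1 : b ≤ 1 := le_of_mul_le_mul_right (by linarith) (mul_pos hnk0 hnl0)
  have hg1 : g1 ≤ 1 := le_of_mul_le_mul_right (by linarith) (mul_pos hno0 hni0)
  have hg2 : g2 ≤ 1 := le_of_mul_le_mul_right (by linarith) (mul_pos hno0 hnl0)
  have hc0 : 0 < c := lt_of_le_of_lt (by positivity) hc
  have hq : 0 < ni * nj * nk * nl := by positivity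
  have hqa : 0 < no * ni * nj * nk := by positivity
  have hqb : 0 < no * nl * nj * nk := by positivity
  have hn' : c ≤ (1 - a) * (1 - b) := le_of_mul_le_mul_right (by linarith) hq
  have he' : ri * rl * c ≤ (a - ri * rj) * (b - rk * rl) :=
    le_of_mul_le_mul_right (by linarith) hq
  have hna' : a ≤ (1 - g1) * (1 - c) := le_of_mul_le_mul_right (by linarith) hqa
  have hnb' : b ≤ (1 - g2) * (1 - c) := le_of_mul_le_mul_right (by linarith) hqb
  have hga : g1 ≤ 1 - a := by linarith [mul_nonneg (sub_nonneg.2 hg1) hc0.le]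
  have hgb : g2 ≤ 1 - b := by linarith [mul_nonneg (sub_nonneg.2 hg2) hc0.le]
  have hea' : a * ro * rk ≤ (c - rj * rk) * (1 - a) := by
    rcases hro0.eq_or_lt with rfl | h0
    · have := mul_nonneg (sub_pos.2 hc).le (sub_nonneg.2 ha1)
      linarith
    · have h1 := hea (by positivity)
      have h2 : a * ro * rk ≤ (g1 - ro * ri) * (c - rj * rk) :=
        le_of_mul_le_mul_right (by linarith) hqa
      have h3 : 0 < ro * ri := by positivity
      have h4 : g1 - ro * ri ≤ 1 - a := by linarith
      linarith [mul_le_mul_of_nonneg_right h4 (sub_pos.2 hc).le]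
  have heb' : b * ro * rj ≤ (c - rj * rk) * (1 - b) := by
    rcases hro0.eq_or_lt with rfl | h0
    · have := mul_nonneg (sub_pos.2 hc).le (sub_nonneg.2 hb1)
      linarith
    · have h1 := heb (by positivity)
      have h2 : b * ro * rj ≤ (g2 - ro * rl) * (c - rj * rk) :=
        le_of_mul_le_mul_right (by linarith) hqb
      have h3 : 0 < ro * rl := by positivity
      have h4 : g2 - ro * rl ≤ 1 - b := by linarith
      linarith [mul_le_mul_of_nonneg_right h4 (sub_pos.2 hc).le]
  exact sqrt_estimate_of_normalized hri0 hrj0 hrk0 hrl0 hro0 hri' hrl' ha.le hb.le ha1 hb1 hc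
    hn' he' hea' heb'

theorem one_add_sq_lt_of_lower_bound {q₀ q K : ℝ} (h0 : 0 < q₀) (h1 : q₀ ≤ q) (hq : q ≤ 1)
    (h : (1 + q₀) ^ 2 < q₀ * K ^ 2) : (1 + q) ^ 2 < q * K ^ 2 := by
  have h2 : (1 + q) ^ 2 * q₀ ≤ (1 + q₀) ^ 2 * q := by
    have : 0 ≤ 1 - q * q₀ := by nlinarith
    linarith [mul_nonneg (sub_nonneg.2 h1) this]
  have h3 : (1 + q₀) ^ 2 * q < q₀ * K ^ 2 * q := mul_lt_mul_of_pos_right h (by linarith)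
  exact lt_of_mul_lt_mul_right (by linarith) h0.le

theorem one_add_ratio_mul_sq_lt {m x y : ℝ} (hm : 0 < m) (hmx : m ≤ x) (hmy : m ≤ y)
    (hx : x ≤ 1 / 2) (hy : y ≤ 1 / 2) (hsum : m + x + y = 1) :
    (1 + x / (x + 1 / 2) * (y / (y + 1 / 2))) ^ 2 <
      x / (x + 1 / 2) * (y / (y + 1 / 2)) * (5 / 2 + 9 / 8 * (m / (m + 1 / 2))) ^ 2 := by
  have hx0 : 0 < x := by linarith
  have hy0 : 0 < y := by linarith
  have hq : x / (x + 1 / 2) * (y / (y + 1 / 2)) = x * y / (x * y + (3 / 4 - m / 2)) := by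
    rw [div_mul_div_comm]
    congr 1
    linear_combination (1 / 2) * hsum
  have hK : 5 / 2 + 9 / 8 * (m / (m + 1 / 2)) = (29 * m + 10) / (8 * m + 4) := by
    field_simp; ring
  have hq1 : x * y / (x * y + (3 / 4 - m / 2)) ≤ 1 := by
    rw [div_le_one (by nlinarith)]; linarith
  have hmono : ∀ p, 0 < p → p ≤ x * y →
      p / (p + (3 / 4 - m / 2)) ≤ x * y / (x * y + (3 / 4 - m / 2)) := fun p hp h => by
    have : 0 < 3 / 4 - m / 2 := by linarith
    rw [div_le_div_iff₀ (by positivity) (by positivity)]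
    linarith [mul_le_mul_of_nonneg_right h this.le]
  rw [hq, hK]
  rcases le_total m (1 / 4) with h | h
  · have hp : 0 < 1 / 4 - m / 2 := by linarith
    have hd : 1 / 4 - m / 2 + (3 / 4 - m / 2) = 1 - m := by ring
    have h1m : 0 < 1 - m := by linarith
    refine one_add_sq_lt_of_lower_bound (q₀ := (1 / 4 - m / 2) / (1 - m)) (by positivity) ?_ hq1 ?_
    · rw [← hd]
      exact hmono _ hp (by linarith [mul_nonneg (sub_nonneg.2 hx) (sub_nonneg.2 hy)])
    · have : 0 < 120 - 283 * m - 979 * m ^ 2 + 1106 * m ^ 3 := by nlinarith [pow_pos hm 3]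
      have h2 := mul_pos hm this
      rw [← sub_pos]
      have : (1 / 4 - m / 2) / (1 - m) * ((29 * m + 10) / (8 * m + 4)) ^ 2 -
          (1 + (1 / 4 - m / 2) / (1 - m)) ^ 2 =
          m * (120 - 283 * m - 979 * m ^ 2 + 1106 * m ^ 3) / (4 * (1 - m) ^ 2 * (8 * m + 4) ^ 2) := by
        field_simp; ring
      rw [this]; positivity
  · have hm3 : m ≤ 1 / 3 := by linarith
    have hp : 0 < m - 2 * m ^ 2 := by nlinarith
    have hd : m - 2 * m ^ 2 + (3 / 4 - m / 2) = (3 - 4 * m) * (1 + 2 * m) / 4 := by ring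
    have h34 : 0 < 3 - 4 * m := by linarith
    refine one_add_sq_lt_of_lower_bound
      (q₀ := (m - 2 * m ^ 2) / ((3 - 4 * m) * (1 + 2 * m) / 4)) (by positivity) ?_ hq1 ?_
    · rw [← hd]
      refine hmono _ hp ?_
      have : y = 1 - m - x := by linarith
      subst this
      linarith [mul_nonneg (sub_nonneg.2 hmx) (sub_nonneg.2 hmy)]
    · have h1 : 16 * (3 + 6 * m - 16 * m ^ 2) ^ 2 * (1 + 2 * m) <
          4 * (m - 2 * m ^ 2) * (3 - 4 * m) * (29 * m + 10) ^ 2 := by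
        obtain ⟨u, rfl⟩ : ∃ u, m = 1 / 4 + u := ⟨m - 1 / 4, by ring⟩
        have hu : 0 ≤ u := by linarith
        have hu' : u ≤ 1 / 12 := by linarith
        nlinarith [mul_nonneg hu hu, pow_nonneg hu 3, pow_nonneg hu 4,
          mul_nonneg hu (sub_nonneg.2 hu'), mul_nonneg (pow_nonneg hu 3) (sub_nonneg.2 hu'),
          mul_nonneg (pow_nonneg hu 2) (sub_nonneg.2 hu')]
      rw [← sub_pos] at h1 ⊢
      have : (m - 2 * m ^ 2) / ((3 - 4 * m) * (1 + 2 * m) / 4) *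
          ((29 * m + 10) / (8 * m + 4)) ^ 2 -
          (1 + (m - 2 * m ^ 2) / ((3 - 4 * m) * (1 + 2 * m) / 4)) ^ 2 =
          (4 * (m - 2 * m ^ 2) * (3 - 4 * m) * (29 * m + 10) ^ 2 -
          16 * (3 + 6 * m - 16 * m ^ 2) ^ 2 * (1 + 2 * m)) /
          ((3 - 4 * m) ^ 2 * (1 + 2 * m) * (8 * m + 4) ^ 2) := by
        obtain ⟨d, hd'⟩ : ∃ d, d = 3 - 4 * m := ⟨_, rfl⟩
        rw [← hd'] at h34 ⊢
        field_simp
        rw [hd']; ring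
      rw [this]; positivity

theorem sqrt_estimate_middle {m x y : ℝ} (hm : 0 < m) (hmx : m ≤ x) (hmy : m ≤ y)
    (hx : x ≤ 1 / 2) (hy : y ≤ 1 / 2) (hsum : m + x + y = 1) :
    let ρ := √(x / (x + 1 / 2) * (y / (y + 1 / 2)))
    (1 - 2 * ρ) * (1 - ρ / 2) < 9 / 8 * (m / (m + 1 / 2)) * ρ := by
  intro ρ
  have h := one_add_ratio_mul_sq_lt hm hmx hmy hx hy hsum
  have hx0 : 0 < x := by linarith
  have hy0 : 0 < y := by linarith
  have hρ2 : ρ ^ 2 = x / (x + 1 / 2) * (y / (y + 1 / 2)) := Real.sq_sqrt (by positivity)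
  have hρ : 0 ≤ ρ := Real.sqrt_nonneg _
  have hr : 0 < m / (m + 1 / 2) := by positivity
  rw [← hρ2, ← mul_pow] at h
  have := (sq_lt_sq₀ (by positivity) (by positivity)).1 h
  linarith

theorem not_sqrt_estimate_middle {m x y : ℝ} (hm : 0 ≤ m) (hmx : m ≤ x) (hmy : m ≤ y)
    (hx : x ≤ 1 / 2) (hy : y ≤ 1 / 2) (hsum : m + x + y = 1) :
    let ρ := √(x / (x + 1 / 2) * (y / (y + 1 / 2)))
    let θ := √((1 / 2 : ℝ) / (1 / 2 + 1 / 2) * ((1 / 2) / (1 / 2 + 1 / 2)))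
    ¬ (0 < 1 - ρ - 2 * θ * ρ ∧
      m / (m + 1 / 2) * ρ * θ * (1 + θ) ^ 2 ≤ (1 - ρ - 2 * θ * ρ) * (1 - θ * ρ)) := by
  intro ρ θ
  have hθ : θ = 1 / 2 := by
    have : (1 / 2 : ℝ) / (1 / 2 + 1 / 2) * ((1 / 2) / (1 / 2 + 1 / 2)) = (1 / 2) ^ 2 := by norm_num
    simp only [θ]
    rw [this, Real.sqrt_sq (by norm_num)]
  rintro ⟨h1, h2⟩
  rw [hθ] at h1 h2
  rcases hm.eq_or_lt with rfl | hm
  · obtain rfl : x = 1 / 2 := by linarith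
    obtain rfl : y = 1 / 2 := by linarith
    have : ρ = 1 / 2 := hθ
    linarith
  · have := sqrt_estimate_middle hm hmx hmy hx hy hsum
    simp only at this
    linarith

theorem not_sqrt_estimate_side {m x y : ℝ} (hm : 0 ≤ m) (hmx : m ≤ x) (hmy : m ≤ y)
    (hx : x ≤ 1 / 2) (hy : y ≤ 1 / 2) (hsum : m + x + y = 1) :
    let ρ := √((1 / 2 : ℝ) / (1 / 2 + 1 / 2) * (y / (y + 1 / 2)))
    let θ := √(x / (x + 1 / 2) * ((1 / 2) / (1 / 2 + 1 / 2)))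
    ¬ (0 < 1 - ρ - 2 * θ * ρ ∧
      m / (m + 1 / 2) * ρ * θ * (1 + θ) ^ 2 ≤ (1 - ρ - 2 * θ * ρ) * (1 - θ * ρ)) := by
  intro ρ θ
  have half : √((1 / 2 : ℝ) / (1 / 2 + 1 / 2) * ((1 / 2) / (1 / 2 + 1 / 2))) = 1 / 2 := by
    have : (1 / 2 : ℝ) / (1 / 2 + 1 / 2) * ((1 / 2) / (1 / 2 + 1 / 2)) = (1 / 2) ^ 2 := by norm_num
    rw [this, Real.sqrt_sq (by norm_num)]
  rintro ⟨h1, h2⟩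
  rcases hm.eq_or_lt with rfl | hm
  · obtain rfl : x = 1 / 2 := by linarith
    obtain rfl : y = 1 / 2 := by linarith
    have hρ : ρ = 1 / 2 := half
    have hθ : θ = 1 / 2 := half
    rw [hρ, hθ] at h1
    norm_num at h1
  · have h3 := sqrt_estimate_middle hm hmx hmy hx hy hsum
    have hx0 : 0 < x := by linarith
    have hy0 : 0 < y := by linarith
    have hle : ∀ z : ℝ, 0 < z → z ≤ 1 / 2 → z / (z + 1 / 2) ≤ 1 / 2 := fun z h0 h => by
      rw [div_le_iff₀ (by linarith)]; linarith
    have hxr : 0 < x / (x + 1 / 2) := by positivity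
    have hyr : 0 < y / (y + 1 / 2) := by positivity
    have hxr' := hle x hx0 hx
    have hyr' := hle y hy0 hy
    have hr : 0 < m / (m + 1 / 2) := by positivity
    have hr' : m / (m + 1 / 2) ≤ 2 / 5 := by
      rw [div_le_iff₀ (by linarith)]; linarith
    have hτ : √(x / (x + 1 / 2) * (y / (y + 1 / 2))) = 2 * (θ * ρ) := by
      rw [← Real.sqrt_mul (by positivity), Real.sqrt_eq_iff_mul_self_eq (by positivity)
        (by positivity), mul_mul_mul_comm, Real.mul_self_sqrt (by positivity)]
      ring
    simp only [hτ] at h3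
    have hρ0 : 0 < ρ := Real.sqrt_pos.2 (by positivity)
    have hθ0 : 0 < θ := Real.sqrt_pos.2 (by positivity)
    have hρ1 : ρ ≤ 1 / 2 := by
      rw [← half]; apply Real.sqrt_le_sqrt; norm_num at hyr' ⊢; linarith
    have hθ1 : θ ≤ 1 / 2 := by
      rw [← half]; apply Real.sqrt_le_sqrt; norm_num at hxr' ⊢; linarith
    generalize m / (m + 1 / 2) = r at *
    clear_value ρ θ
    have h4 : θ * ρ ≤ 1 / 2 * (1 / 2) := by gcongr
    have h5 : r * θ * (5 / 2 + θ) ≤ 2 / 5 * (1 / 2) * (5 / 2 + 1 / 2) := by gcongr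
    have h6 : 0 ≤ (2 * (1 - θ * ρ) - r * θ * (5 / 2 + θ)) * (ρ * (1 / 2 - θ)) :=
      mul_nonneg (by linarith) (mul_nonneg hρ0.le (by linarith))
    linarith

theorem quarter_mul_le_of_fourCycle {m1 m3 m4 a b c d u y : ℝ} (hm1 : m1 ≤ 1 / 2) (hm3 : m3 ≤ 1 / 2)
    (hm4 : 0 ≤ m4) (h13 : 2 / 3 ≤ m1 + m3) (ha : 0 ≤ a) (hb : 0 ≤ b) (hc : 0 ≤ c) (hd : 0 ≤ d)
    (hc1 : c ^ 2 ≤ 1) (hw : m1 / 2 < a ^ 2) (hz : m3 / 2 < d ^ 2) (hv : m1 * m3 < b ^ 2)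
    (hu : m4 / 2 < u) (hy : m4 / 2 < y)
    (he1 : y * m3 / 2 ≤ (d ^ 2 - m3 / 2) * (u - m4 / 2))
    (he3 : u * m1 / 2 ≤ (a ^ 2 - m1 / 2) * (y - m4 / 2))
    (hn : b ^ 2 ≤ (m1 + 1 / 2 - a ^ 2) * (m3 + 1 / 2 - d ^ 2)) (hn3 : d ^ 2 ≤ m3 + 1 / 2)
    (h4 : (a * b * (1 / 2) + c * d * m1) ^ 2 <
      (a ^ 2 * (1 / 2) + c ^ 2 * m1 - 1 / 2 * m1 * (1 / 2)) *
        (b ^ 2 * (1 / 2) + d ^ 2 * m1 - m3 * m1 * (1 / 2))) :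
    b ^ 2 / 4 ≤ (d ^ 2 - m3 / 2) * (a ^ 2 - m1 / 2) := by
  have hm1' : 0 < m1 := by linarith
  have hm3' : 0 < m3 := by linarith
  have h5 : 2 * (a * b * c * d) <
      (d ^ 2 - m3 / 2) * (a ^ 2 - m1 / 2) + c ^ 2 * (b ^ 2 - m1 * m3) - b ^ 2 / 4 := by
    refine lt_of_mul_lt_mul_right ?_ (by positivity : 0 ≤ m1 / 2)
    linarith
  have hp : 1 / 2 * (m1 + m3 - 1 / 2) ≤ m1 * m3 := by
    linarith [mul_nonneg (sub_nonneg.2 hm1) (sub_nonneg.2 hm3)]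
  have hWZ : m1 * m3 ≤ a ^ 2 * d ^ 2 := by
    obtain ⟨W, hW⟩ : ∃ W, W = a ^ 2 - m1 / 2 := ⟨_, rfl⟩
    obtain ⟨Z, hZ⟩ : ∃ Z, Z = d ^ 2 - m3 / 2 := ⟨_, rfl⟩
    have hW0 : 0 < W := by linarith
    have hZ0 : 0 < Z := by linarith
    rw [← hW] at he3
    rw [← hZ] at he1
    rw [show a ^ 2 = W + m1 / 2 by linarith, show d ^ 2 = Z + m3 / 2 by linarith]
    have huy : 0 < u * y := mul_pos (by linarith) (by linarith)
    have h1 : u * y * (m1 * m3 / 4) ≤ u * y * (W * Z) := by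
      have h2 : y * m3 / 2 ≤ Z * u := he1.trans (by gcongr; linarith)
      have h3 : u * m1 / 2 ≤ W * y := he3.trans (by gcongr; linarith)
      have h4 : 0 ≤ y := by linarith
      have h5 : 0 ≤ u := by linarith
      have := mul_le_mul h2 h3 (by positivity) (by positivity)
      linarith
    have h2 : m1 * m3 / 4 ≤ W * Z := le_of_mul_le_mul_left h1 huy
    have h3 : m1 * m3 ≤ m1 * Z + m3 * W := by
      refine (sq_le_sq₀ (by positivity) (by positivity)).1 ?_
      have := mul_le_mul_of_nonneg_left h2 (by positivity : 0 ≤ m1 * m3)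
      linarith [sq_nonneg (m1 * Z - m3 * W)]
    linarith
  have hv' : b ^ 2 ≤ (1 + m1) / 2 * ((1 + m3) / 2) := by
    refine hn.trans (mul_le_mul ?_ ?_ ?_ ?_) <;> linarith
  have hV : (b ^ 2 - m1 * m3) ^ 2 ≤ 4 * b ^ 2 * (m1 * m3) := by
    have h6 : b ^ 2 ≤ 11 / 2 * (m1 * m3) := by linarith
    generalize b ^ 2 = v at *
    have : 0 < m1 * m3 := by positivity
    nlinarith [mul_nonneg (sub_pos.2 hv).le (sub_nonneg.2 h6)]
  have hcV : c ^ 2 * (b ^ 2 - m1 * m3) ≤ 2 * (a * b * c * d) := by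
    refine (sq_le_sq₀ (mul_nonneg (sq_nonneg c) (by linarith)) (by positivity)).1 ?_
    calc (c ^ 2 * (b ^ 2 - m1 * m3)) ^ 2 = c ^ 2 * (c ^ 2 * (b ^ 2 - m1 * m3) ^ 2) := by ring
      _ ≤ c ^ 2 * (1 * (4 * b ^ 2 * (a ^ 2 * d ^ 2))) := by
        gcongr
        exact hV.trans (by gcongr)
      _ = (2 * (a * b * c * d)) ^ 2 := by ring
  linarith

set_option maxHeartbeats 2000000 in
theorem false_of_quadForm_bounds {m1 m3 m4 a12 a13 a24 a25 a35 a45 : ℝ}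
    (hm1 : 0 ≤ m1) (hm3 : 0 ≤ m3) (hm4 : 0 ≤ m4) (hm1' : m1 ≤ 1 / 2) (hm3' : m3 ≤ 1 / 2)
    (hm4' : m4 ≤ 1 / 2) (hsum : m1 + m3 + m4 = 1)
    (h12 : 0 ≤ a12) (h13 : 0 ≤ a13) (h24 : 0 ≤ a24) (h25 : 0 ≤ a25) (h35 : 0 ≤ a35)
    (h45 : 0 ≤ a45)
    (hle : ∀ x1 x2 x3 x4 x5 : ℝ, (x1 = 0 ∨ x2 = 0 ∨ x3 = 0 ∨ x4 = 0 ∨ x5 = 0) →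
      2 * (a12 * x1 * x2 + a13 * x1 * x3 + a24 * x2 * x4 + a25 * x2 * x5 + a35 * x3 * x5 +
        a45 * x4 * x5) ≤
      (m1 + 1 / 2) * x1 ^ 2 + x2 ^ 2 + (m3 + 1 / 2) * x3 ^ 2 + (m4 + 1 / 2) * x4 ^ 2 + x5 ^ 2)
    (hlt : ∀ p q : Fin 5 → ℝ, ∃ x1 x2 x3 x4 x5 : ℝ,
      p 0 * x1 + p 1 * x2 + p 2 * x3 + p 3 * x4 + p 4 * x5 = 0 ∧
      q 0 * x1 + q 1 * x2 + q 2 * x3 + q 3 * x4 + q 4 * x5 = 0 ∧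
      m1 * x1 ^ 2 + 1 / 2 * x2 ^ 2 + m3 * x3 ^ 2 + m4 * x4 ^ 2 + 1 / 2 * x5 ^ 2 <
      2 * (a12 * x1 * x2 + a13 * x1 * x3 + a24 * x2 * x4 + a25 * x2 * x5 + a35 * x3 * x5 +
        a45 * x4 * x5)) : False := by
  have half : (0 : ℝ) < 1 / 2 := by norm_num
  have hn1 : 0 < m1 + 1 / 2 := by linarith
  have hn3 : 0 < m3 + 1 / 2 := by linarith
  have hn4 : 0 < m4 + 1 / 2 := by linarith
  have d1 := quarticForm_path_le (ni := m3 + 1 / 2) (nj := 1) (nk := m4 + 1 / 2) (nl := 1)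
    hn3 one_pos h35 h45 h24 fun xi xj xk xl hi hj hk hl => by
      have := hle 0 xl xi xk xj (Or.inl rfl)
      have : 0 ≤ a25 * xl * xj := by positivity
      linarith
  have d2 := quarticForm_path_le (ni := m1 + 1 / 2) (nj := m3 + 1 / 2) (nk := 1)
    (nl := m4 + 1 / 2) hn1 hn4 h13 h35 h45 fun xi xj xk xl hi hj hk hl => by
      have := hle xi 0 xj xl xk (by simp)
      linarith
  have d3 := quarticForm_path_le (ni := m1 + 1 / 2) (nj := 1) (nk := m4 + 1 / 2)
    (nl := 1) hn1 one_pos h12 h24 h45 fun xi xj xk xl hi hj hk hl => by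
      have := hle xi xj 0 xk xl (by simp)
      have : 0 ≤ a25 * xj * xl := by positivity
      linarith
  have d4 := quarticForm_path_le (ni := 1) (nj := m1 + 1 / 2) (nk := m3 + 1 / 2)
    (nl := 1) one_pos one_pos h12 h13 h35 fun xi xj xk xl hi hj hk hl => by
      have := hle xj xi xk 0 xl (by simp)
      have : 0 ≤ a25 * xi * xl := by positivity
      linarith
  have d5 := quarticForm_path_le (ni := m4 + 1 / 2) (nj := 1) (nk := m1 + 1 / 2)
    (nl := m3 + 1 / 2) hn4 hn3 h24 h12 h13 fun xi xj xk xl hi hj hk hl => by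
      have := hle xk xj xl xi 0 (by simp)
      linarith
  have e1 : 0 < m3 → _ := fun h => lt_quarticForm_path (mi := m3) (mj := 1 / 2) (mk := m4)
    (ml := 1 / 2) (p := a35) h half hm4 h45 h24 h25 fun α β => by
      obtain ⟨x1, x2, x3, x4, x5, hp, hq, hx⟩ := hlt ![1, 0, 0, 0, 0] ![0, 0, 0, -α, β]
      simp at hp hq
      subst hp
      exact ⟨x3, x5, x4, x2, by linarith, by linarith⟩
  have e2 : 0 < m1 → 0 < m4 → _ := fun h h' => lt_quarticForm_path (mi := m1) (mj := m3)
    (mk := 1 / 2) (ml := m4) (p := a13) h h' half.le h35 h45 le_rfl fun α β => by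
      obtain ⟨x1, x2, x3, x4, x5, hp, hq, hx⟩ := hlt ![0, 1, 0, 0, 0] ![0, 0, β, 0, -α]
      simp at hp hq
      subst hp
      exact ⟨x1, x3, x5, x4, by linarith, by linarith⟩
  have e3 : 0 < m1 → _ := fun h => lt_quarticForm_path (mi := m1) (mj := 1 / 2) (mk := m4)
    (ml := 1 / 2) (p := a12) h half hm4 h24 h45 h25 fun α β => by
      obtain ⟨x1, x2, x3, x4, x5, hp, hq, hx⟩ := hlt ![0, 0, 1, 0, 0] ![0, β, 0, -α, 0]
      simp at hp hq
      subst hp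
      exact ⟨x1, x2, x4, x5, by linarith, by linarith⟩
  have e5 : 0 < m4 → 0 < m3 → _ := fun h h' => lt_quarticForm_path (mi := m4) (mj := 1 / 2)
    (mk := m1) (ml := m3) (p := a24) h h' hm1 h12 h13 le_rfl fun α β => by
      obtain ⟨x1, x2, x3, x4, x5, hp, hq, hx⟩ := hlt ![0, 0, 0, 0, 1] ![-α, β, 0, 0, 0]
      simp at hp hq
      subst hp
      exact ⟨x4, x2, x1, x3, by linarith, by linarith⟩
  have f45 : 1 / 2 * m4 < a45 ^ 2 := by
    obtain ⟨x1, x2, x3, x4, x5, hp, hq, hx⟩ := hlt ![0, 1, 0, 0, 0] ![0, 0, 1, 0, 0]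
    simp at hp hq
    subst hp hq
    have : 0 ≤ m1 * x1 ^ 2 := by positivity
    exact mul_lt_sq_of_quadForm (x := x5) (y := x4) half (by linarith)
  have f24 : 1 / 2 * m4 < a24 ^ 2 := by
    obtain ⟨x1, x2, x3, x4, x5, hp, hq, hx⟩ := hlt ![1, 0, 0, 0, 0] ![0, 0, 0, 0, 1]
    simp at hp hq
    subst hp hq
    have : 0 ≤ m3 * x3 ^ 2 := by positivity
    exact mul_lt_sq_of_quadForm (x := x2) (y := x4) half (by linarith)
  have f13 : 0 < m3 → m3 * m1 < a13 ^ 2 := fun h => by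
    obtain ⟨x1, x2, x3, x4, x5, hp, hq, hx⟩ := hlt ![0, 1, 0, 0, 0] ![0, 0, 0, 0, 1]
    simp at hp hq
    subst hp hq
    have : 0 ≤ m4 * x4 ^ 2 := by positivity
    exact mul_lt_sq_of_quadForm (x := x3) (y := x1) h (by linarith)
  by_cases c1 : m1 ≤ m3 ∧ m1 ≤ m4
  · have p3 : 0 < m3 := by linarith [c1.1, c1.2]
    have p4 : 0 < m4 := by linarith [c1.1, c1.2]
    refine not_sqrt_estimate_side hm1 c1.1 c1.2 hm3' hm4' (by linarith)
      (sqrt_estimate_of_path (E1 := a35 ^ 2) (F := a45 ^ 2) (E2 := a24 ^ 2) (G1 := a13 ^ 2)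
        (G2 := a12 ^ 2) p3 half p4 half hm1 hm3' le_rfl (e1 p3).1 f45 (e1 p3).2.1 (e1 p3).2.2
        (fun h => ?_) (fun h => ?_) ?_ ?_ ?_ ?_ ?_ ?_ ?_)
    · linarith [(e2 h p4).2.2]
    · linarith [(e3 h).2.2]
    all_goals first
      | linarith only [hsum, d1.1]
      | linarith only [hsum, d1.2.1]
      | linarith only [hsum, d1.2.2]
      | linarith only [hsum, d2.1]
      | linarith only [hsum, d2.2.2]
      | linarith only [hsum, d3.1]
      | linarith only [hsum, d3.2.2]
  by_cases c3 : m3 ≤ m1 ∧ m3 ≤ m4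
  · have p1 : 0 < m1 := by linarith [c3.1, c3.2]
    have p4 : 0 < m4 := by linarith [c3.1, c3.2]
    refine not_sqrt_estimate_side hm3 c3.1 c3.2 hm1' hm4' (by linarith)
      (sqrt_estimate_of_path (E1 := a12 ^ 2) (F := a24 ^ 2) (E2 := a45 ^ 2) (G1 := a13 ^ 2)
        (G2 := a35 ^ 2) p1 half p4 half hm3 hm1' le_rfl (e3 p1).1 f24 (e3 p1).2.1 (e3 p1).2.2
        (fun h => ?_) (fun h => ?_) ?_ ?_ ?_ ?_ ?_ ?_ ?_)
    · linarith [(e5 p4 h).2.2]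
    · linarith [(e1 h).2.2]
    all_goals first
      | linarith only [hsum, d3.1]
      | linarith only [hsum, d3.2.1]
      | linarith only [hsum, d3.2.2]
      | linarith only [hsum, d5.1]
      | linarith only [hsum, d5.2.1]
      | linarith only [hsum, d5.2.2]
      | linarith only [hsum, d1.1]
      | linarith only [hsum, d1.2.2]
  have c41 : m4 ≤ m1 := by
    by_contra! h
    exact c3 ⟨by by_contra! h'; exact c1 ⟨h'.le, h.le⟩, by
      by_contra! h'; exact c1 ⟨by linarith, h.le⟩⟩
  have c43 : m4 ≤ m3 := by
    by_contra! h
    exact c1 ⟨by by_contra! h'; exact c3 ⟨h'.le, h.le⟩, by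
      by_contra! h'; exact c3 ⟨by linarith, h.le⟩⟩
  have p1 : 0 < m1 := by linarith
  have p3 : 0 < m3 := by linarith
  have hc1 : a25 ^ 2 ≤ 1 := by
    have := hle 0 1 0 0 1 (by simp)
    nlinarith
  have g4 := lt_quadForm_fourCycle (mi := m1) (mj := 1 / 2) (mk := m3) (ml := 1 / 2)
    (a := a12) (b := a13) (c := a25) (d := a35) p1 half
    (by linarith [(e3 p1).1, mul_nonneg (sq_nonneg a25) hm1]) fun α β => by
      obtain ⟨x1, x2, x3, x4, x5, hp, hq, hx⟩ := hlt ![0, 0, 0, 1, 0] ![0, β, -α, 0, 0]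
      simp at hp hq
      subst hp
      exact ⟨x1, x2, x3, x5, by linarith, by linarith⟩
  have e4 := quarter_mul_le_of_fourCycle (u := a24 ^ 2) (y := a45 ^ 2) hm1' hm3' hm4 (by linarith)
    h12 h13 h25 h35 hc1 (by linarith [(e3 p1).1]) (by linarith [(e1 p3).1])
    (by linarith [f13 p3]) (by linarith) (by linarith) (by linarith [(e1 p3).2.2])
    (by linarith [(e3 p1).2.2]) (by linarith [d4.2.2]) (by linarith [d4.2.1]) g4
  refine not_sqrt_estimate_middle hm4 c43 c41 hm3' hm1' (by linarith)
    (sqrt_estimate_of_path (E1 := a35 ^ 2) (F := a13 ^ 2) (E2 := a12 ^ 2) (G1 := a45 ^ 2)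
      (G2 := a24 ^ 2) half p3 p1 half hm4 le_rfl le_rfl (by linarith [(e1 p3).1]) (f13 p3)
      (by linarith [(e3 p1).1]) (by linarith) (fun h => ?_) (fun h => ?_) ?_ ?_ ?_ ?_ ?_ ?_ ?_)
  · linarith [(e2 p1 h).2.2]
  · linarith [(e5 h p3).2.2]
  all_goals first
    | linarith only [hsum, d4.1]
    | linarith only [hsum, d4.2.1]
    | linarith only [hsum, d4.2.2]
    | linarith only [hsum, d2.1]
    | linarith only [hsum, d2.2.1]
    | linarith only [hsum, d2.2.2]
    | linarith only [hsum, d5.1]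
    | linarith only [hsum, d5.2.2]

/-- Pattern H: if every principal 4×4 submatrix of `A` has spectral radius at
most 1, then `l3 ≤ 1/2`. -/
theorem stmt_11
    (s t a12 a13 a24 a25 a35 a45 : ℝ)
    (hs : 0 ≤ s) (ht : 0 ≤ t) (h12n : 0 ≤ a12) (h13n : 0 ≤ a13)
    (h24n : 0 ≤ a24) (h25n : 0 ≤ a25) (h35n : 0 ≤ a35) (h45n : 0 ≤ a45)
    (hts : t + s ≤ 1/2)
    (A : Matrix (Fin 5) (Fin 5) ℝ)
    (hA : A = !![1/2 - t - s, a12, a13, 0, 0;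
                 a12, 0, 0, a24, a25;
                 a13, 0, t, 0, a35;
                 0, a24, 0, s, a45;
                 0, a25, a35, a45, 0])
    (l1 l2 l3 l4 l5 : ℝ)
    (hord1 : l1 ≥ l2) (hord2 : l2 ≥ l3) (hord3 : l3 ≥ l4) (hord4 : l4 ≥ l5)
    (heig : A.charpoly.roots = {l1, l2, l3, l4, l5})
    (hsub : ∀ k : Fin 5,
      spectralRadius ℝ (A.submatrix k.succAbove k.succAbove) ≤ 1) :
    l3 ≤ 1/2 := by
  by_contra! hl
  have hH : A.IsHermitian := by
    ext i j
    fin_cases i <;> fin_cases j <;> simp [hA]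
  have form : ∀ x : Fin 5 → ℝ, x ⬝ᵥ A *ᵥ x =
      (1 / 2 - t - s) * x 0 ^ 2 + t * x 2 ^ 2 + s * x 3 ^ 2 +
      2 * (a12 * x 0 * x 1 + a13 * x 0 * x 2 + a24 * x 1 * x 3 + a25 * x 1 * x 4 +
        a35 * x 2 * x 4 + a45 * x 3 * x 4) := fun x => by
    simp [hA, dotProduct, mulVec, Fin.sum_univ_five]
    ring
  have norm : ∀ x : Fin 5 → ℝ, x ⬝ᵥ x = x 0 ^ 2 + x 1 ^ 2 + x 2 ^ 2 + x 3 ^ 2 + x 4 ^ 2 :=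
    fun x => by simp [dotProduct, Fin.sum_univ_five, sq]
  have hle : ∀ (k : Fin 5) (x : Fin 5 → ℝ), x k = 0 → x ⬝ᵥ A *ᵥ x ≤ x ⬝ᵥ x := fun k x hx => by
    have := dotProduct_mulVec_le_of_spectralRadius_le_one (hH.submatrix k.succAbove) (hsub k)
      (x ∘ k.succAbove)
    simpa [dotProduct, mulVec, Fin.sum_univ_succAbove _ k, hx] using this
  refine false_of_quadForm_bounds (m1 := t + s) (m3 := 1 / 2 - t) (m4 := 1 / 2 - s)
    (by linarith) (by linarith) (by linarith) hts (by linarith) (by linarith) (by ring)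
    h12n h13n h24n h25n h35n h45n (fun x1 x2 x3 x4 x5 hx => ?_) fun p q => ?_
  · have h : ![x1, x2, x3, x4, x5] ⬝ᵥ A *ᵥ ![x1, x2, x3, x4, x5] ≤
        ![x1, x2, x3, x4, x5] ⬝ᵥ ![x1, x2, x3, x4, x5] := by
      rcases hx with h | h | h | h | h
      exacts [hle 0 _ h, hle 1 _ h, hle 2 _ h, hle 3 _ h, hle 4 _ h]
    rw [form, norm] at h
    simp at h
    linarith
  · obtain ⟨x, hp, hq, hx⟩ := exists_lt_dotProduct_mulVec_of_card hH
      (two_lt_card_of_roots_charpoly hH hord1 hord2 hl heig) p q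
    rw [form, norm] at hx
    refine ⟨x 0, x 1, x 2, x 3, x 4, ?_, ?_, by linarith⟩
    · simpa [dotProduct, Fin.sum_univ_five] using hp
    · simpa [dotProduct, Fin.sum_univ_five] using hq
end

section
/- Under the stated assumptions on B, one has b12 ≥ b35, b24 ≥ b35, and b45 ≥ b13; moreover, if b33 ≥ b44 then also b24 ≥ b13. -/
open Filter Topology Matrix

theorem HasDerivAt.eventually_pos {f : ℝ → ℝ} {d : ℝ} (hf : HasDerivAt f d 0)
    (h : 0 < f 0 ∨ 0 ≤ f 0 ∧ 0 < d) : ∀ᶠ t in 𝓝[>] (0 : ℝ), 0 < f t := by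
  rcases h with h | ⟨h, hd⟩
  · exact nhdsWithin_le_nhds (hf.continuousAt.eventually_const_lt h)
  · have hslope := (hasDerivAt_iff_tendsto_slope.1 hf).eventually_const_lt hd
    have hle : 𝓝[>] (0 : ℝ) ≤ 𝓝[≠] 0 := nhdsWithin_mono _ fun x hx => ne_of_gt hx
    filter_upwards [hle hslope, self_mem_nhdsWithin] with t ht ht0
    have ht0 : 0 < t := ht0
    rw [slope_def_field, sub_zero] at ht
    have := (div_pos_iff_of_pos_right ht0).1 ht
    linarith

section Conjugation

open NormedSpace

variable {n : Type*} [Fintype n] [DecidableEq n]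

attribute [local instance] Matrix.linftyOpNormedRing Matrix.linftyOpNormedAlgebra
  Matrix.linftyOpNormedAddCommGroup Matrix.linftyOpNormedSpace

theorem Matrix.hasDerivAt_exp_conj (A K : Matrix n n ℝ) :
    HasDerivAt (fun t : ℝ => exp (t • (-K)) * A * exp (t • K)) (A * K - K * A) 0 := by
  have h := ((hasDerivAt_exp_smul_const (𝕂 := ℝ) (-K) 0).mul_const A).mul
    (hasDerivAt_exp_smul_const (𝕂 := ℝ) K 0)
  refine h.congr_deriv ?_
  simp only [zero_smul, exp_zero, one_mul, mul_one]
  noncomm_ring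

/-- If moving from `A` along the orthogonal orbit in the skew direction `K` makes every
non-positive entry increase, then `A` is orthogonally similar to a positive matrix. -/
theorem Matrix.exists_orthogonal_conj_pos (A K : Matrix n n ℝ) (hK : Kᵀ = -K)
    (h : ∀ i j, 0 < A i j ∨ 0 ≤ A i j ∧ 0 < (A * K - K * A) i j) :
    ∃ Q : Matrix n n ℝ, Qᵀ * Q = 1 ∧ ∀ i j, 0 < (Qᵀ * A * Q) i j := by
  have hev : ∀ᶠ t in 𝓝[>] (0 : ℝ), ∀ i j, 0 < (exp (t • (-K)) * A * exp (t • K)) i j := by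
    refine eventually_all.2 fun i => eventually_all.2 fun j => ?_
    have hd := hasDerivAt_pi.1 (hasDerivAt_pi.1 (hasDerivAt_exp_conj A K) i) j
    refine hd.eventually_pos ?_
    simpa using h i j
  obtain ⟨t, ht⟩ := hev.exists
  have hQ : (exp (t • K))ᵀ = exp (t • (-K)) := by
    rw [← exp_transpose, transpose_smul, hK]
  refine ⟨exp (t • K), ?_, by rwa [hQ]⟩
  rw [hQ, ← Matrix.exp_add_of_commute _ _ (by rw [smul_neg]; exact (Commute.refl _).neg_left)]
  simp

end Conjugation

/-- A two-scale version of `Matrix.exists_orthogonal_conj_pos`: entries that are stationary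
along `K` may be pushed up by a second skew direction `L`. -/
theorem Matrix.exists_orthogonal_conj_pos_of_pair {n : Type*} [Fintype n] [DecidableEq n]
    (A K L : Matrix n n ℝ) (hK : Kᵀ = -K) (hL : Lᵀ = -L)
    (h : ∀ i j, 0 < A i j ∨ 0 ≤ A i j ∧ (0 < (A * K - K * A) i j ∨
      0 ≤ (A * K - K * A) i j ∧ 0 < (A * L - L * A) i j)) :
    ∃ Q : Matrix n n ℝ, Qᵀ * Q = 1 ∧ ∀ i j, 0 < (Qᵀ * A * Q) i j := by
  have hev : ∀ᶠ t in 𝓝[>] (0 : ℝ), ∀ i j, 0 < A i j ∨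
      0 ≤ A i j ∧ 0 < (A * K - K * A) i j + t * (A * L - L * A) i j := by
    refine eventually_all.2 fun i => eventually_all.2 fun j => ?_
    rcases h i j with h | ⟨h0, h⟩
    · exact Eventually.of_forall fun _ => Or.inl h
    · have hd : HasDerivAt (fun t : ℝ => (A * K - K * A) i j + t * (A * L - L * A) i j)
          ((A * L - L * A) i j) 0 := by
        simpa using ((hasDerivAt_id (0 : ℝ)).mul_const ((A * L - L * A) i j)).const_add
          ((A * K - K * A) i j)
      filter_upwards [hd.eventually_pos (by simpa using h)] with t ht
      exact Or.inr ⟨h0, ht⟩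
  obtain ⟨t, ht⟩ := hev.exists
  refine exists_orthogonal_conj_pos A (K + t • L) ?_ fun i j => ?_
  · rw [transpose_add, transpose_smul, hK, hL, smul_neg, neg_add]
  · have : A * (K + t • L) - (K + t • L) * A = (A * K - K * A) + t • (A * L - L * A) := by
      rw [mul_add, add_mul, Matrix.mul_smul, Matrix.smul_mul, smul_sub]
      abel
    rw [this]
    simpa using ht i j

/-- The skew-symmetric `5 × 5` matrix with the given entries above the diagonal. -/
def skewMatrixFive (k12 k13 k14 k15 k23 k24 k25 k34 k35 k45 : ℝ) : Matrix (Fin 5) (Fin 5) ℝ :=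
  !![0, k12, k13, k14, k15;
     -k12, 0, k23, k24, k25;
     -k13, -k23, 0, k34, k35;
     -k14, -k24, -k34, 0, k45;
     -k15, -k25, -k35, -k45, 0]

theorem transpose_skewMatrixFive (k12 k13 k14 k15 k23 k24 k25 k34 k35 k45 : ℝ) :
    (skewMatrixFive k12 k13 k14 k15 k23 k24 k25 k34 k35 k45)ᵀ =
      -skewMatrixFive k12 k13 k14 k15 k23 k24 k25 k34 k35 k45 := by
  ext i j
  fin_cases i <;> fin_cases j <;> simp [skewMatrixFive]

/-- A symmetric matrix whose off-diagonal support is the `5`-cycle `1-2-4-5-3-1` is orthogonally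
similar to a positive matrix as soon as some skew direction moves the entries at `(1,4)`, `(2,5)`,
`(2,2)`, `(4,4)` weakly upwards and those at `(1,5)`, `(2,3)`, `(3,4)` strictly upwards. -/
theorem exists_orthogonal_conj_pos_of_cycle
    {b11 b12 b13 b22 b24 b33 b35 b44 b45 b55 : ℝ}
    (hb22 : 0 ≤ b22) (hb44 : 0 ≤ b44) (hb11 : 0 < b11) (hb33 : 0 < b33) (hb55 : 0 < b55)
    (hb12 : 0 < b12) (hb13 : 0 < b13) (hb24 : 0 < b24) (hb35 : 0 < b35) (hb45 : 0 < b45)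
    (k12 k13 k14 k15 k23 k24 k25 k34 k35 k45 : ℝ)
    (h14 : 0 ≤ -b24 * k12 + b12 * k24 + (b11 - b44) * k14 - b45 * k15 + b13 * k34)
    (h15 : 0 < -b35 * k13 + b13 * k35 - b45 * k14 + (b11 - b55) * k15 + b12 * k25)
    (h23 : 0 < b13 * k12 + b12 * k13 + (b22 - b33) * k23 - b35 * k25 - b24 * k34)
    (h25 : 0 ≤ -b45 * k24 + b24 * k45 + b12 * k15 - b35 * k23 + (b22 - b55) * k25)
    (h34 : 0 < -b45 * k35 - b35 * k45 + b13 * k14 + b24 * k23 + (b33 - b44) * k34)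
    (h22 : 0 ≤ b12 * k12 - b24 * k24)
    (h44 : 0 ≤ b24 * k24 - b45 * k45) :
    ∃ Q : Matrix (Fin 5) (Fin 5) ℝ, Qᵀ * Q = 1 ∧ ∀ i j, 0 < (Qᵀ *
      !![b11, b12, b13, 0, 0;
         b12, b22, 0, b24, 0;
         b13, 0, b33, 0, b35;
         0, b24, 0, b44, b45;
         0, 0, b35, b45, b55] * Q) i j := by
  obtain ⟨l12, hl12⟩ : ∃ x, b24 < b12 * x := ⟨b24 / b12 + 1, by field_simp; linarith⟩
  obtain ⟨l15, hl15⟩ : ∃ x, b24 * l12 < b45 * x :=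
    ⟨b24 * l12 / b45 + 1, by field_simp; linarith⟩
  obtain ⟨l23, hl23⟩ : ∃ x, b45 + b12 * l15 < b35 * x :=
    ⟨(b45 + b12 * l15) / b35 + 1, by field_simp; linarith⟩
  refine exists_orthogonal_conj_pos_of_pair _
    (skewMatrixFive k12 k13 k14 k15 k23 k24 k25 k34 k35 k45)
    (skewMatrixFive l12 0 0 (-l15) (-l23) 1 0 0 0 0)
    (transpose_skewMatrixFive ..) (transpose_skewMatrixFive ..) fun i j => ?_
  fin_cases i <;> fin_cases j <;>
    simp only [skewMatrixFive, Matrix.sub_apply, Matrix.mul_apply, Fin.sum_univ_five] <;>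
    simp <;>
    first
    | (left; linarith)
    | (right; constructor <;> linarith)
    | exact Or.inr ⟨by assumption, Or.inr ⟨by linarith, by linarith⟩⟩


/-- Pattern C: under the stated assumptions on `B` (in particular `B` is not
orthogonally similar to a positive symmetric matrix), one has `b12 ≥ b35`,
`b24 ≥ b35`, `b45 ≥ b13`, and if `b33 ≥ b44` then also `b24 ≥ b13`. -/
theorem stmt_12
    (b11 b12 b13 b22 b24 b33 b35 b44 b45 b55 : ℝ)
    (hb22n : 0 ≤ b22) (hb44n : 0 ≤ b44)
    (htr : b11 + b22 + b33 + b44 + b55 = 1/2)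
    (h2211 : b22 ≤ b11) (h2233 : b22 ≤ b33) (h2244 : b22 ≤ b44) (h2255 : b22 ≤ b55)
    (hb11 : 0 < b11) (hb11u : b11 < 1/2)
    (hb4411 : b44 ≤ b11) (hb44u : b44 < 1/2)
    (hb33 : 0 < b33) (hb33u : b33 < 1/2)
    (hb55 : 0 < b55) (hb55u : b55 < 1/2)
    (hb12 : 0 < b12) (hb13 : 0 < b13) (hb24 : 0 < b24) (hb35 : 0 < b35) (hb45 : 0 < b45)
    (B : Matrix (Fin 5) (Fin 5) ℝ)
    (hB : B = !![b11, b12, b13, 0, 0;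
                 b12, b22, 0, b24, 0;
                 b13, 0, b33, 0, b35;
                 0, b24, 0, b44, b45;
                 0, 0, b35, b45, b55])
    (hnos : ¬ ∃ Q : Matrix (Fin 5) (Fin 5) ℝ, Q.transpose * Q = 1 ∧
        ∀ i j, 0 < (Q.transpose * B * Q) i j) :
    b12 ≥ b35 ∧ b24 ≥ b35 ∧ b45 ≥ b13 ∧ (b33 ≥ b44 → b24 ≥ b13) := by
  subst hB
  have key := @exists_orthogonal_conj_pos_of_cycle b11 b12 b13 b22 b24 b33 b35 b44 b45 b55
    hb22n hb44n hb11 hb33 hb55 hb12 hb13 hb24 hb35 hb45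
  refine ⟨?_, ?_, ?_, fun h3344 => ?_⟩ <;> by_contra! hlt <;> apply hnos
  · obtain ⟨δ, hδ, hδb⟩ := exists_pos_mul_lt (sub_pos.2 hlt) b13
    have := mul_pos hb45 hδ
    apply key 0 (-1) 0 0 0 0 (-1) 0 (-δ) 0 <;> linarith
  · obtain ⟨δ, hδ, hδb⟩ := exists_pos_mul_lt (sub_pos.2 hlt) b45
    obtain ⟨ε, hε, hεb⟩ := exists_pos_mul_lt (mul_pos hb13 hδ) b35
    have := mul_pos hb12 hε
    apply key 0 ε 0 0 (-1) 0 0 0 δ (-1) <;> linarith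
  · obtain ⟨δ, hδ, hδb⟩ := exists_pos_mul_lt (sub_pos.2 hlt) b35
    have := mul_pos hb12 hδ
    apply key 0 δ 1 0 0 0 0 0 1 0 <;> linarith
  · obtain ⟨δ, hδ, hδb⟩ := exists_pos_mul_lt (sub_pos.2 hlt) b12
    obtain ⟨ε, hε, hεb⟩ := exists_pos_mul_lt (mul_pos hb35 hδ) b13
    have := mul_pos hb45 hε
    apply key 1 (-δ) 0 0 0 0 0 1 (-ε) 0 <;> linarith
end

section
/- The following hold: (1) if ρ(M) ≤ 1 then y2 < √((1 − x1)(1 − x3)) and y3 ≤ √((1 − x4)·(1 − x2 − (1 − x3)·y1² / ((1 − x1)(1 − x3) − y2²))); (2) if y2 ≤ (1/2)·√((1 − 2x1)(1 − 2x3)) then μ2 ≤ 1/2; (3) if y2 > (1/2)·√((1 − 2x1)(1 − 2x3)) and y3 ≤ (1/2)·√((1 − 2x4)·(1 − 2x2 + 4(1 − 2x3)·y1² / (4y2² − (1 − 2x1)(1 − 2x3)))), then μ2 ≤ 1/2. -/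
/-- If the characteristic polynomial of a real `4 × 4` matrix has four roots, its determinantal
expression factors over them. -/
lemma det_scalar_sub_eq_of_roots {M : Matrix (Fin 4) (Fin 4) ℝ} {m1 m2 m3 m4 : ℝ}
    (h : M.charpoly.roots = {m1, m2, m3, m4}) (t : ℝ) :
    (Matrix.scalar (Fin 4) t - M).det = (t - m1) * (t - m2) * (t - m3) * (t - m4) := by
  have hprod := Polynomial.prod_multiset_X_sub_C_of_monic_of_roots_card_eq M.charpoly_monic
    (by rw [h, Matrix.charpoly_natDegree_eq_dim]; simp)
  rw [← Matrix.eval_charpoly, ← hprod, h]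
  simp [mul_assoc]

/-- The characteristic polynomial of a weighted path on the vertices `4 - 2 - 1 - 3`. -/
lemma det_scalar_sub_path (x1 x2 x3 x4 y1 y2 y3 t : ℝ) :
    (Matrix.scalar (Fin 4) t - !![x1, y1, y2, 0; y1, x2, 0, y3; y2, 0, x3, 0; 0, y3, 0, x4]).det =
      ((t - x1) * (t - x3) - y2 ^ 2) * ((t - x2) * (t - x4) - y3 ^ 2)
        - y1 ^ 2 * ((t - x3) * (t - x4)) := by
  simp [Matrix.det_succ_row_zero, Fin.sum_univ_succ, Fin.succAbove, Matrix.scalar_apply]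
  ring

lemma abs_le_one_of_spectralRadius_le_one {n : Type*} [Fintype n] [DecidableEq n]
    {M : Matrix n n ℝ} (h : spectralRadius ℝ M ≤ 1) {m : ℝ} (hm : m ∈ M.charpoly.roots) :
    |m| ≤ 1 := by
  have hspec : m ∈ spectrum ℝ M :=
    Matrix.mem_spectrum_iff_isRoot_charpoly.2 (Polynomial.isRoot_of_mem_roots hm)
  have hle : (‖m‖₊ : ENNReal) ≤ 1 :=
    (le_iSup₂ (f := fun k (_ : k ∈ spectrum ℝ M) => (‖k‖₊ : ENNReal)) m hspec).trans h
  exact_mod_cast hle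

section Path

variable {x1 x2 x3 x4 y1 y2 y3 : ℝ}

/-- Two roots, counted with multiplicity, of the path polynomial beyond both end weights `x3` and
`x4` give opposite signs to the characteristic polynomial of the block `{1, 3}`. -/
lemma path_block_mul_block_neg {u v w z : ℝ} (hy1 : 0 < y1)
    (hP : ∀ t, ((t - x1) * (t - x3) - y2 ^ 2) * ((t - x2) * (t - x4) - y3 ^ 2)
        - y1 ^ 2 * ((t - x3) * (t - x4)) = (t - u) * (t - v) * (t - w) * (t - z))
    (hu3 : x3 < u) (hu4 : x4 < u) (hv3 : x3 < v) (hv4 : x4 < v) :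
    ((u - x1) * (u - x3) - y2 ^ 2) * ((v - x1) * (v - x3) - y2 ^ 2) < 0 := by
  have hPu := hP u
  have hPv := hP v
  rw [sub_self, zero_mul, zero_mul, zero_mul] at hPu
  rw [sub_self, mul_zero, zero_mul, zero_mul] at hPv
  have hdiff : (u + v - x1 - x3) * ((u - x2) * (u - x4) - y3 ^ 2)
      + ((v - x1) * (v - x3) - y2 ^ 2) * (u + v - x2 - x4)
      - y1 ^ 2 * (u + v - x3 - x4) = 0 := by
    linear_combination (u ^ 2 + u * v + v ^ 2 - 1) * ((hP 2 - 4 * ((hP 1 + hP (-1)) / 2 - hP 0) - hP 0 - hP 1 + hP (-1)) / 6)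
      + (u + v) * ((hP 1 + hP (-1)) / 2 - hP 0) + (hP 1 - hP (-1)) / 2
  have hu3' := sub_pos.2 hu3
  have hu4' := sub_pos.2 hu4
  have hv3' := sub_pos.2 hv3
  have hv4' := sub_pos.2 hv4
  have hkey : ((u - x3) * (v - x3) + y2 ^ 2) * (v - x4) * ((u - x2) * (u - x4) - y3 ^ 2)
      + ((u - x4) * (v - x4) + y3 ^ 2) * (u - x3) * ((v - x1) * (v - x3) - y2 ^ 2) = 0 := by
    linear_combination (v - x3) * (v - x4) * hdiff - (u + v - x3 - x4) * hPv
  generalize (u - x1) * (u - x3) - y2 ^ 2 = Fu at *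
  generalize (v - x1) * (v - x3) - y2 ^ 2 = Fv at *
  generalize (u - x2) * (u - x4) - y3 ^ 2 = Gu at *
  have hA : 0 < ((u - x3) * (v - x3) + y2 ^ 2) * (v - x4) := by positivity
  have hB : 0 < ((u - x4) * (v - x4) + y3 ^ 2) * (u - x3) := by positivity
  have hFG : 0 < Fu * Gu := by
    have : 0 < y1 ^ 2 * ((u - x3) * (u - x4)) := by positivity
    linarith
  have hsum : ((u - x3) * (v - x3) + y2 ^ 2) * (v - x4) * (Fu * Gu)
      + ((u - x4) * (v - x4) + y3 ^ 2) * (u - x3) * (Fu * Fv) = 0 := by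
    linear_combination Fu * hkey
  by_contra! hcon
  linarith [mul_pos hA hFG, mul_nonneg hB.le hcon]

/-- The third largest eigenvalue of the path lies below every bound for the end weights. -/
lemma path_third_root_lt {c m1 m2 m3 m4 : ℝ} (hy1 : 0 < y1) (hx3 : x3 < c) (hx4 : x4 < c)
    (h12 : m2 ≤ m1) (h23 : m3 ≤ m2)
    (hP : ∀ t, ((t - x1) * (t - x3) - y2 ^ 2) * ((t - x2) * (t - x4) - y3 ^ 2)
        - y1 ^ 2 * ((t - x3) * (t - x4)) = (t - m1) * (t - m2) * (t - m3) * (t - m4)) :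
    m3 < c := by
  by_contra! hc
  have h12' := path_block_mul_block_neg hy1 hP
    (by linarith) (by linarith) (by linarith) (by linarith)
  have h13' := path_block_mul_block_neg (u := m1) (v := m3) (w := m2) (z := m4) hy1
    (fun t => by rw [hP]; ring) (by linarith) (by linarith) (by linarith) (by linarith)
  have h23' := path_block_mul_block_neg (u := m2) (v := m3) (w := m1) (z := m4) hy1
    (fun t => by rw [hP]; ring) (by linarith) (by linarith) (by linarith) (by linarith)
  generalize (m1 - x1) * (m1 - x3) - y2 ^ 2 = F1 at *
  generalize (m2 - x1) * (m2 - x3) - y2 ^ 2 = F2 at *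
  generalize (m3 - x1) * (m3 - x3) - y2 ^ 2 = F3 at *
  nlinarith [mul_pos_of_neg_of_neg h12' h13', sq_nonneg F1]

/-- If the path polynomial is nonpositive at a bound for the end weights, the second largest
eigenvalue does not exceed that bound. -/
lemma path_second_root_le_of_nonpos {c m1 m2 m3 m4 : ℝ} (hy1 : 0 < y1) (hx3 : x3 < c)
    (hx4 : x4 < c) (h12 : m2 ≤ m1) (h23 : m3 ≤ m2) (h34 : m4 ≤ m3)
    (hP : ∀ t, ((t - x1) * (t - x3) - y2 ^ 2) * ((t - x2) * (t - x4) - y3 ^ 2)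
        - y1 ^ 2 * ((t - x3) * (t - x4)) = (t - m1) * (t - m2) * (t - m3) * (t - m4))
    (hc : ((c - x1) * (c - x3) - y2 ^ 2) * ((c - x2) * (c - x4) - y3 ^ 2)
        - y1 ^ 2 * ((c - x3) * (c - x4)) ≤ 0) :
    m2 ≤ c := by
  have h3 := path_third_root_lt hy1 hx3 hx4 h12 h23 hP
  by_contra! h2
  have hpos : 0 < (m1 - c) * (m2 - c) * ((c - m3) * (c - m4)) :=
    mul_pos (mul_pos (by linarith) (by linarith)) (mul_pos (by linarith) (by linarith))
  rw [hP] at hc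
  linarith

/-- Positivity of the path polynomial propagates to the right of a point where both blocks
`{1, 3}` and `{2, 4}` have nonnegative characteristic polynomials. -/
lemma path_pos_of_le {c t : ℝ} (hct : c ≤ t) (hx3 : x3 < c) (hx4 : x4 < c)
    (hF : 0 ≤ (c - x1) * (c - x3) - y2 ^ 2) (hG : 0 ≤ (c - x2) * (c - x4) - y3 ^ 2)
    (hc : 0 < ((c - x1) * (c - x3) - y2 ^ 2) * ((c - x2) * (c - x4) - y3 ^ 2)
        - y1 ^ 2 * ((c - x3) * (c - x4))) :
    0 < ((t - x1) * (t - x3) - y2 ^ 2) * ((t - x2) * (t - x4) - y3 ^ 2)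
        - y1 ^ 2 * ((t - x3) * (t - x4)) := by
  have hc3 : 0 < c - x3 := by linarith
  have hc4 : 0 < c - x4 := by linarith
  have ht3 : 0 < t - x3 := by linarith
  have ht4 : 0 < t - x4 := by linarith
  have htc : 0 ≤ t - c := by linarith
  have hFt : (t - x3) * ((c - x1) * (c - x3) - y2 ^ 2)
      ≤ (c - x3) * ((t - x1) * (t - x3) - y2 ^ 2) := by
    have : 0 ≤ (t - c) * ((c - x3) * (t - x3) + y2 ^ 2) := by positivity
    linarith
  have hGt : (t - x4) * ((c - x2) * (c - x4) - y3 ^ 2)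
      ≤ (c - x4) * ((t - x2) * (t - x4) - y3 ^ 2) := by
    have : 0 ≤ (t - c) * ((c - x4) * (t - x4) + y3 ^ 2) := by positivity
    linarith
  have hmul := mul_le_mul hFt hGt (by positivity) ((mul_nonneg ht3.le hF).trans hFt)
  have hpos := mul_pos (mul_pos ht3 ht4) hc
  refine pos_of_mul_pos_right (a := (c - x3) * (c - x4)) ?_ (by positivity)
  linarith

/-- If all eigenvalues of the path are at most `c`, the block `{1, 3}` has a positive
characteristic polynomial at `c`. -/
lemma path_block_pos_of_roots_le {c m1 m2 m3 m4 : ℝ} (hy1 : 0 < y1)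
    (hx3 : x3 < c) (hx4 : x4 < c)
    (h1 : m1 ≤ c) (h2 : m2 ≤ c) (h3 : m3 ≤ c) (h4 : m4 ≤ c)
    (hP : ∀ t, ((t - x1) * (t - x3) - y2 ^ 2) * ((t - x2) * (t - x4) - y3 ^ 2)
        - y1 ^ 2 * ((t - x3) * (t - x4)) = (t - m1) * (t - m2) * (t - m3) * (t - m4)) :
    0 < (c - x1) * (c - x3) - y2 ^ 2 := by
  by_contra! hF
  obtain ⟨t, hct, ht⟩ : ∃ t, c ≤ t ∧ (t - x1) * (t - x3) - y2 ^ 2 = 0 := by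
    have hs := Real.sq_sqrt (show 0 ≤ (x1 - x3) ^ 2 + 4 * y2 ^ 2 by positivity)
    have hle : 2 * c - x1 - x3 ≤ √((x1 - x3) ^ 2 + 4 * y2 ^ 2) :=
      Real.le_sqrt_of_sq_le (by linarith)
    exact ⟨(x1 + x3 + √((x1 - x3) ^ 2 + 4 * y2 ^ 2)) / 2, by linarith, by
      linear_combination hs / 4⟩
  have hPt := hP t
  have hneg : 0 < y1 ^ 2 * ((t - x3) * (t - x4)) :=
    mul_pos (by positivity) (mul_pos (by linarith) (by linarith))
  have hnonneg : 0 ≤ (t - m1) * (t - m2) * (t - m3) * (t - m4) :=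
    mul_nonneg (mul_nonneg (mul_nonneg (by linarith) (by linarith)) (by linarith)) (by linarith)
  rw [ht] at hPt
  linarith

end Path

/-- The 4×4 lemma: bounds on `y2`, `y3` from `ρ(M) ≤ 1`, and sufficient
conditions for the second largest eigenvalue `m2` of `M` to be at most 1/2. -/
theorem stmt_13
    (x1 x2 x3 x4 y1 y2 y3 : ℝ)
    (hx1 : 0 ≤ x1) (hx1u : x1 < 1/2) (hx2 : 0 ≤ x2) (hx2u : x2 < 1/2)
    (hx3 : 0 ≤ x3) (hx3u : x3 < 1/2) (hx4 : 0 ≤ x4) (hx4u : x4 < 1/2)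
    (hy1 : 0 < y1) (hy2 : 0 < y2) (hy3 : 0 < y3)
    (htr : x1 + x2 + x3 + x4 ≤ 1/2)
    (M : Matrix (Fin 4) (Fin 4) ℝ)
    (hM : M = !![x1, y1, y2, 0;
                 y1, x2, 0, y3;
                 y2, 0, x3, 0;
                 0, y3, 0, x4])
    (m1 m2 m3 m4 : ℝ)
    (hord1 : m1 ≥ m2) (hord2 : m2 ≥ m3) (hord3 : m3 ≥ m4)
    (heig : M.charpoly.roots = {m1, m2, m3, m4}) :
    (spectralRadius ℝ M ≤ 1 →
      y2 < Real.sqrt ((1 - x1) * (1 - x3)) ∧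
      y3 ≤ Real.sqrt ((1 - x4) *
        (1 - x2 - (1 - x3) * y1^2 / ((1 - x1) * (1 - x3) - y2^2)))) ∧
    (y2 ≤ 1/2 * Real.sqrt ((1 - 2*x1) * (1 - 2*x3)) → m2 ≤ 1/2) ∧
    (y2 > 1/2 * Real.sqrt ((1 - 2*x1) * (1 - 2*x3)) ∧
      y3 ≤ 1/2 * Real.sqrt ((1 - 2*x4) *
        (1 - 2*x2 + 4 * (1 - 2*x3) * y1^2 / (4*y2^2 - (1 - 2*x1) * (1 - 2*x3)))) →
      m2 ≤ 1/2) := by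
  have hP : ∀ t, ((t - x1) * (t - x3) - y2 ^ 2) * ((t - x2) * (t - x4) - y3 ^ 2)
      - y1 ^ 2 * ((t - x3) * (t - x4)) = (t - m1) * (t - m2) * (t - m3) * (t - m4) := fun t => by
    rw [← det_scalar_sub_eq_of_roots heig, hM, det_scalar_sub_path]
  have hsecond := path_second_root_le_of_nonpos hy1 hx3u hx4u hord1 hord2 hord3 hP
  refine ⟨fun hρ => ?_, fun h => ?_, fun ⟨h, h'⟩ => ?_⟩
  · have hle : ∀ m ∈ ({m1, m2, m3, m4} : Multiset ℝ), m ≤ 1 := fun m hm =>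
      (abs_le.1 (abs_le_one_of_spectralRadius_le_one hρ (heig ▸ hm))).2
    simp only [Multiset.insert_eq_cons, Multiset.mem_cons, Multiset.mem_singleton,
      forall_eq_or_imp, forall_eq] at hle
    obtain ⟨h1, h2, h3, h4⟩ := hle
    have hF := path_block_pos_of_roots_le hy1 (by linarith) (by linarith)
      h1 h2 h3 h4 hP
    have hP1 : 0 ≤ (1 - m1) * (1 - m2) * (1 - m3) * (1 - m4) :=
      mul_nonneg (mul_nonneg (mul_nonneg (by linarith) (by linarith)) (by linarith)) (by linarith)
    rw [← hP] at hP1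
    refine ⟨Real.lt_sqrt_of_sq_lt (by linarith), Real.le_sqrt_of_sq_le ?_⟩
    rw [mul_sub, mul_div_assoc', le_sub_comm, div_le_iff₀ hF]
    linarith
  · have hF : 0 ≤ (1 / 2 - x1) * (1 / 2 - x3) - y2 ^ 2 := by
      have := (Real.le_sqrt' (y := (1 - 2 * x1) * (1 - 2 * x3))
        (by positivity : 0 < 2 * y2)).1 (by linarith)
      linarith
    by_cases hc : ((1 / 2 - x1) * (1 / 2 - x3) - y2 ^ 2) * ((1 / 2 - x2) * (1 / 2 - x4) - y3 ^ 2)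
        - y1 ^ 2 * ((1 / 2 - x3) * (1 / 2 - x4)) ≤ 0
    · exact hsecond hc
    push Not at hc
    have hG : 0 ≤ (1 / 2 - x2) * (1 / 2 - x4) - y3 ^ 2 := by
      have : 0 < y1 ^ 2 * ((1 / 2 - x3) * (1 / 2 - x4)) :=
        mul_pos (by positivity) (mul_pos (by linarith) (by linarith))
      exact (pos_of_mul_pos_right (by linarith) hF).le
    by_contra! h2
    have hpos := path_pos_of_le h2.le hx3u hx4u hF hG hc
    rw [hP] at hpos
    simp at hpos
  · have hF : 0 < 4 * y2 ^ 2 - (1 - 2 * x1) * (1 - 2 * x3) := by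
      have := (Real.sqrt_lt' (x := (1 - 2 * x1) * (1 - 2 * x3))
        (by positivity : 0 < 2 * y2)).1 (by linarith)
      linarith
    have hy3sq := (Real.le_sqrt' (by positivity : 0 < 2 * y3)).1
      (by linarith : 2 * y3 ≤ √((1 - 2 * x4) * (1 - 2 * x2 + 4 * (1 - 2 * x3) * y1 ^ 2 /
        (4 * y2 ^ 2 - (1 - 2 * x1) * (1 - 2 * x3)))))
    refine hsecond ?_
    rw [mul_add, mul_div_assoc', ← sub_le_iff_le_add', le_div_iff₀ hF] at hy3sq
    linarith
end

section
/- Assume ρ(B) ≤ 1, b24 ≥ b35, b12 > (1/2)·√((1 − 2b11)(1 − 2b22)), b24 > (1/2)·√((1 − 2b22)(1 − 2b44)), b45 < (1/2)·√((4·b24²/(1 − 2b22) − (1 − 2b44))·(4·b24²/(1 − 2b33) − (1 − 2b55))), b35 > (1/2)·√((1 − 2b33)(1 − 2b55)), and b45 > (1/2)·√((1 − 2b55)·(1 − 2b44 + 4(1 − 2b11)·b24² / (4·b12² − (1 − 2b11)(1 − 2b22)))). Then b24 > (1/2)·√(1 + 2b11 + 4·b22·b44 + 4·b33·b55). -/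
theorem mul_div_sub_le_of_le_add {p q r s v : ℝ} (hp : 0 < p) (hq : 0 < q) (hs : 0 ≤ s)
    (hv : p * r < v) (hpos : 0 < (v / p - r) * (v / q - s)) (hle : v ≤ p * r + q * s) :
    (v / p - r) * (v / q - s) ≤ r * s := by
  have hX : 0 < v / p - r := by
    rw [sub_pos, lt_div_iff₀ hp]
    linarith
  have hY : 0 < v / q - s := (pos_iff_pos_of_mul_pos hpos).1 hX
  have hXle : v / p - r ≤ q * s / p := by
    rw [sub_le_iff_le_add, div_add' _ _ _ hp.ne']
    gcongr
    linarith
  have hYle : v / q - s ≤ p * r / q := by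
    rw [sub_le_iff_le_add, div_add' _ _ _ hq.ne']
    gcongr
    linarith
  calc (v / p - r) * (v / q - s) ≤ (q * s / p) * (p * r / q) := by gcongr
    _ = r * s := by field_simp

/-- Pattern C: under the listed inequalities,
`b24 > √(1 + 2 b11 + 4 b22 b44 + 4 b33 b55) / 2`. -/
theorem stmt_14
    (b11 b12 b13 b22 b24 b33 b35 b44 b45 b55 : ℝ)
    (hb22n : 0 ≤ b22) (hb44n : 0 ≤ b44)
    (htr : b11 + b22 + b33 + b44 + b55 = 1/2)
    (h2211 : b22 ≤ b11) (h2233 : b22 ≤ b33) (h2244 : b22 ≤ b44) (h2255 : b22 ≤ b55)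
    (hb11 : 0 < b11) (hb11u : b11 < 1/2)
    (hb4411 : b44 ≤ b11) (hb44u : b44 < 1/2)
    (hb33 : 0 < b33) (hb33u : b33 < 1/2)
    (hb55 : 0 < b55) (hb55u : b55 < 1/2)
    (hb12 : 0 < b12) (hb13 : 0 < b13) (hb24 : 0 < b24) (hb35 : 0 < b35) (hb45 : 0 < b45)
    (B : Matrix (Fin 5) (Fin 5) ℝ)
    (hB : B = !![b11, b12, b13, 0, 0;
                 b12, b22, 0, b24, 0;
                 b13, 0, b33, 0, b35;
                 0, b24, 0, b44, b45;
                 0, 0, b35, b45, b55])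
    (hρ : spectralRadius ℝ B ≤ 1)
    (h2435 : b24 ≥ b35)
    (h12lb : b12 > 1/2 * Real.sqrt ((1 - 2*b11) * (1 - 2*b22)))
    (h24lb : b24 > 1/2 * Real.sqrt ((1 - 2*b22) * (1 - 2*b44)))
    (h45ub : b45 < 1/2 * Real.sqrt ((4*b24^2 / (1 - 2*b22) - (1 - 2*b44)) *
        (4*b24^2 / (1 - 2*b33) - (1 - 2*b55))))
    (h35lb : b35 > 1/2 * Real.sqrt ((1 - 2*b33) * (1 - 2*b55)))
    (h45lb : b45 > 1/2 * Real.sqrt ((1 - 2*b55) * (1 - 2*b44 +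
        4 * (1 - 2*b11) * b24^2 / (4*b12^2 - (1 - 2*b11) * (1 - 2*b22))))) :
    b24 > 1/2 * Real.sqrt (1 + 2*b11 + 4*b22*b44 + 4*b33*b55) := by
  have hd1 : 0 < 1 - 2 * b11 := by linarith
  have hd2 : 0 < 1 - 2 * b22 := by linarith
  have hd3 : 0 < 1 - 2 * b33 := by linarith
  have hd5 : 0 < 1 - 2 * b55 := by linarith
  have sq_lt {a x : ℝ} (ha : 0 < a) (h : a > 1/2 * Real.sqrt x) : x < 4 * a^2 := by
    have := (Real.sqrt_lt' (by linarith : 0 < 2 * a)).1 (by linarith : Real.sqrt x < 2 * a)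
    linarith
  have h12 := sq_lt hb12 h12lb
  have h24 := sq_lt hb24 h24lb
  have h45 := sq_lt hb45 h45lb
  have lt_sq {a x : ℝ} (ha : 0 < a) (h : a < 1/2 * Real.sqrt x) : 4 * a^2 < x := by
    have := (Real.lt_sqrt (by linarith : 0 ≤ 2 * a)).1 (by linarith : 2 * a < Real.sqrt x)
    linarith
  have h45_lt := lt_sq hb45 h45ub
  have hfrac : 0 < 4 * (1 - 2*b11) * b24^2 / (4*b12^2 - (1 - 2*b11) * (1 - 2*b22)) :=
    div_pos (by positivity) (by linarith)
  by_contra hcon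
  have hle : 4 * b24^2 ≤ 1 + 2*b11 + 4*b22*b44 + 4*b33*b55 := by
    have := (Real.le_sqrt' (by linarith : 0 < 2 * b24)).1
      (by linarith [not_lt.1 hcon] :
        2 * b24 ≤ Real.sqrt (1 + 2*b11 + 4*b22*b44 + 4*b33*b55))
    linarith
  have hub := mul_div_sub_le_of_le_add hd2 hd3 hd5.le h24
    ((by positivity : 0 < 4 * b45^2).trans h45_lt) (by linarith)
  have := mul_pos hd5 hfrac
  linarith
end

section
/- Assume ρ(B) ≤ 1, b12 < √((1 − b11)(1 − b22)), b45 ≤ √((1 − b55)·(1 − b44 − (1 − b11)·b24² / ((1 − b11)(1 − b22) − b12²))), b12 > (1/2)·√((1 − 2b11)(1 − 2b22)), and b45 > (1/2)·√((1 − 2b55)·(1 − 2b44 + 4(1 − 2b11)·b24² / (4·b12² − (1 − 2b11)(1 − 2b22)))). Then b24 < √((3 − 2b11 − 2b22)(3 − 2b44 − 2b55)) / (2·(2·√((1 − b11)(1 − b55)) + √((1 − 2b11)(1 − 2b55)))). -/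
/-- A two-term Titu (Engel form of Cauchy-Schwarz) inequality. -/
theorem sq_add_le_div_add_div_mul {a b u v : ℝ} (ha : 0 < a) (hb : 0 < b) :
    (2 * (2 * u + v))^2 ≤ (4 * u^2 / a + 4 * v^2 / b) * (4 * a + b) := by
  have h : (4 * u^2 / a + 4 * v^2 / b) * (4 * a + b) - (2 * (2 * u + v))^2 =
      4 * (u * b - 2 * v * a)^2 / (a * b) := by
    field_simp
    ring
  have : 0 ≤ 4 * (u * b - 2 * v * a)^2 / (a * b) := by positivity
  linarith


/-- Pattern C: under the listed inequalities, a sharper upper bound on `b24`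
holds. -/
theorem stmt_15
    (b11 b12 b13 b22 b24 b33 b35 b44 b45 b55 : ℝ)
    (hb22n : 0 ≤ b22) (hb44n : 0 ≤ b44)
    (htr : b11 + b22 + b33 + b44 + b55 = 1/2)
    (h2211 : b22 ≤ b11) (h2233 : b22 ≤ b33) (h2244 : b22 ≤ b44) (h2255 : b22 ≤ b55)
    (hb11 : 0 < b11) (hb11u : b11 < 1/2)
    (hb4411 : b44 ≤ b11) (hb44u : b44 < 1/2)
    (hb33 : 0 < b33) (hb33u : b33 < 1/2)
    (hb55 : 0 < b55) (hb55u : b55 < 1/2)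
    (hb12 : 0 < b12) (hb13 : 0 < b13) (hb24 : 0 < b24) (hb35 : 0 < b35) (hb45 : 0 < b45)
    (B : Matrix (Fin 5) (Fin 5) ℝ)
    (hB : B = !![b11, b12, b13, 0, 0;
                 b12, b22, 0, b24, 0;
                 b13, 0, b33, 0, b35;
                 0, b24, 0, b44, b45;
                 0, 0, b35, b45, b55])
    (hρ : spectralRadius ℝ B ≤ 1)
    (h12ub : b12 < Real.sqrt ((1 - b11) * (1 - b22)))
    (h45ub : b45 ≤ Real.sqrt ((1 - b55) * (1 - b44 -
        (1 - b11) * b24^2 / ((1 - b11) * (1 - b22) - b12^2))))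
    (h12lb : b12 > 1/2 * Real.sqrt ((1 - 2*b11) * (1 - 2*b22)))
    (h45lb : b45 > 1/2 * Real.sqrt ((1 - 2*b55) * (1 - 2*b44 +
        4 * (1 - 2*b11) * b24^2 / (4*b12^2 - (1 - 2*b11) * (1 - 2*b22))))) :
    b24 < Real.sqrt ((3 - 2*b11 - 2*b22) * (3 - 2*b44 - 2*b55)) /
      (2 * (2 * Real.sqrt ((1 - b11) * (1 - b55)) +
        Real.sqrt ((1 - 2*b11) * (1 - 2*b55)))) := by
  have hα : 0 < (1 - b11) * (1 - b22) - b12^2 := by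
    linarith [(Real.lt_sqrt hb12.le).1 h12ub]
  have h12 : Real.sqrt ((1 - 2*b11) * (1 - 2*b22)) < 2 * b12 := by linarith
  have hβ : 0 < 4*b12^2 - (1 - 2*b11) * (1 - 2*b22) := by
    linarith [(Real.sqrt_lt' (by positivity)).1 h12]
  have hz := (Real.le_sqrt' hb45).1 h45ub
  have h45 : Real.sqrt ((1 - 2*b55) * (1 - 2*b44 +
      4 * (1 - 2*b11) * b24^2 / (4*b12^2 - (1 - 2*b11) * (1 - 2*b22)))) < 2 * b45 := by linarith
  have hz' := (Real.sqrt_lt' (by positivity)).1 h45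
  have hu : 0 < (1 - b11) * (1 - b55) := mul_pos (by linarith) (by linarith)
  have hv : 0 < (1 - 2*b11) * (1 - 2*b55) := mul_pos (by linarith) (by linarith)
  have hsu := Real.sq_sqrt hu.le
  have hsv := Real.sq_sqrt hv.le
  have hu' := Real.sqrt_pos.2 hu
  have hv' := Real.sqrt_pos.2 hv
  set u := Real.sqrt ((1 - b11) * (1 - b55))
  set v := Real.sqrt ((1 - 2*b11) * (1 - 2*b55))
  have hcs := sq_add_le_div_add_div_mul (u := u) (v := v) hα hβ
  set α := (1 - b11) * (1 - b22) - b12^2 with hαd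
  set β := 4*b12^2 - (1 - 2*b11) * (1 - 2*b22) with hβd
  have hsum : 4 * α + β = 3 - 2*b11 - 2*b22 := by rw [hαd, hβd]; ring
  have hy : b24^2 * (4 * u^2 / α + 4 * v^2 / β) < 3 - 2*b44 - 2*b55 := by
    rw [hsu, hsv]
    have e : b24^2 * (4 * ((1 - b11) * (1 - b55)) / α + 4 * ((1 - 2*b11) * (1 - 2*b55)) / β) =
        4 * ((1 - b55) * (1 - b44)) - 4 * ((1 - b55) * (1 - b44 - (1 - b11) * b24^2 / α)) +
        (1 - 2*b55) * (1 - 2*b44 + 4 * (1 - 2*b11) * b24^2 / β) -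
        (1 - 2*b55) * (1 - 2*b44) := by ring
    rw [e]
    linarith
  rw [lt_div_iff₀ (by positivity)]
  apply Real.lt_sqrt_of_sq_lt
  rw [mul_pow, ← hsum]
  calc b24^2 * (2 * (2 * u + v))^2
      ≤ b24^2 * ((4 * u^2 / α + 4 * v^2 / β) * (4 * α + β)) := by gcongr
    _ = (4 * α + β) * (b24^2 * (4 * u^2 / α + 4 * v^2 / β)) := by ring
    _ < (4 * α + β) * (3 - 2*b44 - 2*b55) := by gcongr
end
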